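/- arXiv:1907.00626 — 5 statements merged into one kernel-verified Lean document; each statement's English description precedes it below -/
import Mathlib

section
/- Let k be a field and 𝒢 a digraph. For any automorphism σ of 𝒢 and any maps λ : E(𝒢) → k and μ : E(𝒢) → kˣ, the linear map f^σ_{λ,μ} : C(𝒢) → C(𝒢) defined by f^σ_{λ,μ}(v) = σ(v) for every vertex v, and f^σ_{λ,μ}(e) = λ(e)(σ(v₂) − σ(v₁)) + μ(e)σ(e) for every edge e = (v₁, v₂), is a coalgebra automorphism of C(𝒢). -/
open TensorProduct

variable (k : Type*) [Field k] {V : Type*} (E : Set (V × V))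

/-- The underlying vector space of the coalgebra `C(𝒢)`: free on vertices ⊔ edges. -/
abbrev DigraphCoalgebraCarrier : Type _ := (V ⊕ ↥E) →₀ k

/-- Comultiplication of `C(𝒢)`. -/
noncomputable def digraphComul :
    DigraphCoalgebraCarrier k E →ₗ[k] DigraphCoalgebraCarrier k E ⊗[k] DigraphCoalgebraCarrier k E :=
  Finsupp.lift _ k _ fun x =>
    match x with
    | Sum.inl v => Finsupp.single (Sum.inl v) (1 : k) ⊗ₜ[k] Finsupp.single (Sum.inl v) (1 : k)
    | Sum.inr e =>
        Finsupp.single (Sum.inl e.1.1) (1 : k) ⊗ₜ[k] Finsupp.single (Sum.inr e) (1 : k) +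
          Finsupp.single (Sum.inr e) (1 : k) ⊗ₜ[k] Finsupp.single (Sum.inl e.1.2) (1 : k)

/-- Counit of `C(𝒢)`. -/
noncomputable def digraphCounit : DigraphCoalgebraCarrier k E →ₗ[k] k :=
  Finsupp.lift _ k _ (Sum.elim (fun _ => (1 : k)) fun _ => (0 : k))

/-- A digraph automorphism (a bijection of the vertices preserving the edge relation in both
directions) acts on the edges. -/
def edgeMap (σ : V ≃ V) (hσ : ∀ v w : V, (v, w) ∈ E ↔ (σ v, σ w) ∈ E) : ↥E → ↥E :=
  fun e => ⟨(σ e.1.1, σ e.1.2), (hσ e.1.1 e.1.2).1 e.2⟩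

/-- The linear map `f^σ_{λ,μ}` on `C(𝒢)`. -/
noncomputable def fAut (σ : V ≃ V) (hσ : ∀ v w : V, (v, w) ∈ E ↔ (σ v, σ w) ∈ E)
    (lam : ↥E → k) (mu : ↥E → kˣ) :
    DigraphCoalgebraCarrier k E →ₗ[k] DigraphCoalgebraCarrier k E :=
  Finsupp.lift _ k _ fun x =>
    match x with
    | Sum.inl v => Finsupp.single (Sum.inl (σ v)) (1 : k)
    | Sum.inr e =>
        lam e • (Finsupp.single (Sum.inl (σ e.1.2)) (1 : k) -
            Finsupp.single (Sum.inl (σ e.1.1)) (1 : k)) +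
          (mu e : k) • Finsupp.single (Sum.inr (edgeMap E σ hσ e)) (1 : k)

section FAut

variable (σ τ : V ≃ V) (hσ : ∀ v w : V, (v, w) ∈ E ↔ (σ v, σ w) ∈ E)
  (hτ : ∀ v w : V, (v, w) ∈ E ↔ (τ v, τ w) ∈ E) (lam lam' : ↥E → k) (mu mu' : ↥E → kˣ)

@[simp]
theorem digraphComul_single_inl (v : V) :
    digraphComul k E (Finsupp.single (Sum.inl v) 1) =
      Finsupp.single (Sum.inl v) (1 : k) ⊗ₜ[k] Finsupp.single (Sum.inl v) (1 : k) := by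
  simp [digraphComul]

@[simp]
theorem digraphComul_single_inr (e : ↥E) :
    digraphComul k E (Finsupp.single (Sum.inr e) 1) =
      Finsupp.single (Sum.inl e.1.1) (1 : k) ⊗ₜ[k] Finsupp.single (Sum.inr e) (1 : k) +
        Finsupp.single (Sum.inr e) (1 : k) ⊗ₜ[k] Finsupp.single (Sum.inl e.1.2) (1 : k) := by
  simp [digraphComul]

@[simp]
theorem digraphCounit_single_inl (v : V) :
    digraphCounit k E (Finsupp.single (Sum.inl v) 1) = 1 := by
  simp [digraphCounit]

@[simp]
theorem digraphCounit_single_inr (e : ↥E) :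
    digraphCounit k E (Finsupp.single (Sum.inr e) 1) = 0 := by
  simp [digraphCounit]

@[simp]
theorem fAut_single_inl (v : V) :
    fAut k E σ hσ lam mu (Finsupp.single (Sum.inl v) 1) = Finsupp.single (Sum.inl (σ v)) 1 := by
  simp [fAut]

@[simp]
theorem fAut_single_inr (e : ↥E) :
    fAut k E σ hσ lam mu (Finsupp.single (Sum.inr e) 1) =
      lam e • (Finsupp.single (Sum.inl (σ e.1.2)) (1 : k) -
          Finsupp.single (Sum.inl (σ e.1.1)) (1 : k)) +
        (mu e : k) • Finsupp.single (Sum.inr (edgeMap E σ hσ e)) (1 : k) := by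
  simp only [fAut, Finsupp.lift_apply, zero_smul, Finsupp.sum_single_index, one_smul]

variable {k E σ τ hσ hτ lam lam' mu mu'}

theorem digraph_linearMap_ext {M : Type*} [AddCommMonoid M] [Module k M]
    {f g : DigraphCoalgebraCarrier k E →ₗ[k] M}
    (hv : ∀ v, f (Finsupp.single (Sum.inl v) 1) = g (Finsupp.single (Sum.inl v) 1))
    (he : ∀ e, f (Finsupp.single (Sum.inr e) 1) = g (Finsupp.single (Sum.inr e) 1)) :
    f = g :=
  Finsupp.lhom_ext' fun x => LinearMap.ext_ring <| by
    rcases x with v | e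
    · exact hv v
    · exact he e

/-- Two of the maps `f^σ_{λ,μ}` over mutually inverse automorphisms compose to the identity as soon
as their edge coefficients cancel. -/
theorem fAut_comp_eq_id (hστ : ∀ v, σ (τ v) = v)
    (hlam : ∀ e, lam' e + mu' e * lam (edgeMap E τ hτ e) = 0)
    (hmu : ∀ e, (mu' e : k) * mu (edgeMap E τ hτ e) = 1) :
    fAut k E σ hσ lam mu ∘ₗ fAut k E τ hτ lam' mu' = LinearMap.id := by
  refine digraph_linearMap_ext (fun v => by simp [hστ]) fun e => ?_
  have hedge : edgeMap E σ hσ (edgeMap E τ hτ e) = e := by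
    ext <;> exact hστ _
  simp only [LinearMap.comp_apply, fAut_single_inr, fAut_single_inl, map_add, map_smul, map_sub,
    hedge, LinearMap.id_apply, smul_add, smul_smul, hmu, one_smul, ← add_assoc]
  simp only [edgeMap, hστ, ← add_smul]
  have h := hlam e
  simp only [edgeMap] at h
  rw [h, zero_smul, zero_add]

variable (k E σ hσ lam mu)

theorem fAut_bijective : Function.Bijective (fAut k E σ hσ lam mu) := by
  have hσ' : ∀ v w : V, (v, w) ∈ E ↔ (σ.symm v, σ.symm w) ∈ E := fun v w => by
    simp [hσ (σ.symm v)]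
  have hedge (e : ↥E) : edgeMap E σ.symm hσ' (edgeMap E σ hσ e) = e := by
    ext <;> exact σ.symm_apply_apply _
  let nu : ↥E → kˣ := fun e => (mu (edgeMap E σ.symm hσ' e))⁻¹
  let kap : ↥E → k := fun e => -(nu e * lam (edgeMap E σ.symm hσ' e))
  have hleft : fAut k E σ.symm hσ' kap nu ∘ₗ fAut k E σ hσ lam mu = LinearMap.id :=
    fAut_comp_eq_id σ.symm_apply_apply (fun e => by simp [kap, nu, hedge])
      fun e => by simp [nu, hedge]
  have hright : fAut k E σ hσ lam mu ∘ₗ fAut k E σ.symm hσ' kap nu = LinearMap.id :=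
    fAut_comp_eq_id σ.apply_symm_apply (fun e => by simp [kap]) fun e => by simp [nu]
  exact Function.bijective_iff_has_inverse.2
    ⟨_, fun x => LinearMap.congr_fun hleft x, fun x => LinearMap.congr_fun hright x⟩

theorem digraphCounit_comp_fAut :
    digraphCounit k E ∘ₗ fAut k E σ hσ lam mu = digraphCounit k E :=
  digraph_linearMap_ext (fun v => by simp) fun e => by
    simp [-Finsupp.smul_single]

theorem digraphComul_comp_fAut :
    digraphComul k E ∘ₗ fAut k E σ hσ lam mu =
      TensorProduct.map (fAut k E σ hσ lam mu) (fAut k E σ hσ lam mu) ∘ₗ digraphComul k E := by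
  refine digraph_linearMap_ext (fun v => by simp) fun e => ?_
  simp only [LinearMap.comp_apply, fAut_single_inr, fAut_single_inl, digraphComul_single_inr,
    digraphComul_single_inl, map_add, map_smul, map_sub, TensorProduct.map_tmul,
    TensorProduct.tmul_add, TensorProduct.add_tmul, TensorProduct.tmul_sub, TensorProduct.sub_tmul,
    TensorProduct.tmul_smul, ← TensorProduct.smul_tmul', edgeMap]
  module

end FAut

theorem stmt1 (σ : V ≃ V) (hσ : ∀ v w : V, (v, w) ∈ E ↔ (σ v, σ w) ∈ E)
    (lam : ↥E → k) (mu : ↥E → kˣ) :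
    Function.Bijective (fAut k E σ hσ lam mu) ∧
      (∀ c : DigraphCoalgebraCarrier k E,
        digraphCounit k E (fAut k E σ hσ lam mu c) = digraphCounit k E c) ∧
      ∀ c : DigraphCoalgebraCarrier k E,
        digraphComul k E (fAut k E σ hσ lam mu c) =
          TensorProduct.map (fAut k E σ hσ lam mu) (fAut k E σ hσ lam mu)
            (digraphComul k E c) := by
  exact ⟨fAut_bijective k E σ hσ lam mu,
    LinearMap.congr_fun (digraphCounit_comp_fAut k E σ hσ lam mu),
    LinearMap.congr_fun (digraphComul_comp_fAut k E σ hσ lam mu)⟩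
end

section
/- Let k be a field and 𝒢 a digraph. Every coalgebra automorphism f of C(𝒢) is of the form f^σ_{λ,μ}: there exist an automorphism σ of 𝒢 and maps λ : E(𝒢) → k, μ : E(𝒢) → kˣ such that f(v) = σ(v) for every vertex v and f(e) = λ(e)(σ(v₂) − σ(v₁)) + μ(e)σ(e) for every edge e = (v₁, v₂). -/
open TensorProduct

variable (k : Type*) [Field k] {V : Type*} (E : Set (V × V))

/-- The functional `x ⊗ y ↦ x a * y b` on the tensor square of a free module. -/
noncomputable def tensorCoeff (k : Type*) [Field k] {X : Type*} (a b : X) :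
    (X →₀ k) ⊗[k] (X →₀ k) →ₗ[k] k :=
  LinearMap.mul' k k ∘ₗ TensorProduct.map (Finsupp.lapply a) (Finsupp.lapply b)

@[simp]
theorem tensorCoeff_tmul (k : Type*) [Field k] {X : Type*} (a b : X) (x y : X →₀ k) :
    tensorCoeff k a b (x ⊗ₜ[k] y) = x a * y b := by
  simp [tensorCoeff]

@[simp]
theorem digraphComul_vertex (v : V) :
    digraphComul k E (Finsupp.single (Sum.inl v) 1) =
      Finsupp.single (Sum.inl v) 1 ⊗ₜ[k] Finsupp.single (Sum.inl v) 1 := by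
  simp [digraphComul]

@[simp]
theorem digraphComul_edge (e : ↥E) :
    digraphComul k E (Finsupp.single (Sum.inr e) 1) =
      Finsupp.single (Sum.inl e.1.1) 1 ⊗ₜ[k] Finsupp.single (Sum.inr e) 1 +
        Finsupp.single (Sum.inr e) 1 ⊗ₜ[k] Finsupp.single (Sum.inl e.1.2) 1 := by
  simp [digraphComul]

open Classical in
theorem tensorCoeff_digraphComul_vertex_vertex (v w : V) (c : DigraphCoalgebraCarrier k E) :
    tensorCoeff k (Sum.inl v) (Sum.inl w) (digraphComul k E c) =
      if v = w then c (Sum.inl v) else 0 := by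
  suffices h : tensorCoeff k (Sum.inl v) (Sum.inl w) ∘ₗ digraphComul k E =
      if v = w then Finsupp.lapply (Sum.inl v) else 0 by
    have := LinearMap.congr_fun h c
    split_ifs at this ⊢ <;> simpa using this
  refine Finsupp.lhom_ext' fun x => LinearMap.ext_ring ?_
  rcases x with u | e
  · by_cases h : v = w
    · subst h
      by_cases hu : u = v <;> simp [hu]
    · by_cases hu : u = v
      · subst hu
        simp [h]
      · simp [Finsupp.single_apply, h, hu]
  · by_cases h : v = w <;> simp [h]

theorem tensorCoeff_digraphComul_source (e : ↥E) (c : DigraphCoalgebraCarrier k E) :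
    tensorCoeff k (Sum.inl e.1.1) (Sum.inr e) (digraphComul k E c) = c (Sum.inr e) := by
  classical
  suffices h : tensorCoeff k (Sum.inl e.1.1) (Sum.inr e) ∘ₗ digraphComul k E =
      Finsupp.lapply (Sum.inr e) from LinearMap.congr_fun h c
  refine Finsupp.lhom_ext' fun x => LinearMap.ext_ring ?_
  rcases x with u | e'
  · simp [Finsupp.single_apply]
  · by_cases h : e' = e
    · subst h
      simp
    · simp [Finsupp.single_apply, h]

theorem tensorCoeff_digraphComul_target (e : ↥E) (c : DigraphCoalgebraCarrier k E) :
    tensorCoeff k (Sum.inr e) (Sum.inl e.1.2) (digraphComul k E c) = c (Sum.inr e) := by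
  classical
  suffices h : tensorCoeff k (Sum.inr e) (Sum.inl e.1.2) ∘ₗ digraphComul k E =
      Finsupp.lapply (Sum.inr e) from LinearMap.congr_fun h c
  refine Finsupp.lhom_ext' fun x => LinearMap.ext_ring ?_
  rcases x with u | e'
  · simp [Finsupp.single_apply]
  · by_cases h : e' = e
    · subst h
      simp
    · simp [Finsupp.single_apply, h]

theorem tensorCoeff_digraphComul_edge_edge (e e' : ↥E) (c : DigraphCoalgebraCarrier k E) :
    tensorCoeff k (Sum.inr e) (Sum.inr e') (digraphComul k E c) = 0 := by
  suffices h : tensorCoeff k (Sum.inr e) (Sum.inr e') ∘ₗ digraphComul k E = 0 from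
    LinearMap.congr_fun h c
  refine Finsupp.lhom_ext' fun x => LinearMap.ext_ring ?_
  rcases x with u | e'' <;> simp

/-- The nonzero group-like elements of `C(𝒢)` are the vertices. -/
theorem exists_eq_vertex_of_groupLike (g : DigraphCoalgebraCarrier k E) (hg : g ≠ 0)
    (hΔ : digraphComul k E g = g ⊗ₜ[k] g) :
    ∃ v : V, g = Finsupp.single (Sum.inl v) 1 := by
  classical
  have hedge (e : ↥E) : g (Sum.inr e) = 0 := by
    have := tensorCoeff_digraphComul_edge_edge k E e e g
    rw [hΔ] at this
    simpa using this
  have hvertex (v w : V) :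
      g (Sum.inl v) * g (Sum.inl w) = if v = w then g (Sum.inl v) else 0 := by
    rw [← tensorCoeff_digraphComul_vertex_vertex, hΔ, tensorCoeff_tmul]
  obtain ⟨x, hx⟩ := Finsupp.ne_iff.mp hg
  rcases x with v | e
  · refine ⟨v, Finsupp.ext fun y => ?_⟩
    rcases y with w | e
    · by_cases h : v = w
      · subst h
        simpa [show g (Sum.inl v) ≠ 0 from hx] using hvertex v v
      · simpa [h, show g (Sum.inl v) ≠ 0 from hx] using hvertex v w
    · simpa using hedge e
  · exact absurd (hedge e) hx

/-- A skew-primitive element of `C(𝒢)` between the vertices `a` and `b` is a combination of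
`b - a` and, if present, the edge from `a` to `b`. -/
theorem skewPrimitive_eq (a b : V) (c : DigraphCoalgebraCarrier k E)
    (hΔ : digraphComul k E c =
      Finsupp.single (Sum.inl a) 1 ⊗ₜ[k] c + c ⊗ₜ[k] Finsupp.single (Sum.inl b) 1) :
    (∀ e : ↥E, c (Sum.inr e) ≠ 0 → e.1 = (a, b)) ∧
      ∀ v : V, c (Sum.inl v) =
        (c (Sum.inl b) • (Finsupp.single (Sum.inl b) 1 - Finsupp.single (Sum.inl a) 1) :
          DigraphCoalgebraCarrier k E) (Sum.inl v) := by
  classical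
  constructor
  · intro e he
    have hs := tensorCoeff_digraphComul_source k E e c
    have ht := tensorCoeff_digraphComul_target k E e c
    rw [hΔ] at hs ht
    refine Prod.ext ?_ ?_
    · by_contra h
      exact he (by simpa [Finsupp.single_apply, Ne.symm h] using hs.symm)
    · by_contra h
      exact he (by simpa [Finsupp.single_apply, Ne.symm h] using ht.symm)
  · intro v
    have hvertex (v w : V) : (if a = v then c (Sum.inl w) else 0) +
        (if b = w then c (Sum.inl v) else 0) = if v = w then c (Sum.inl v) else 0 := by
      rw [← tensorCoeff_digraphComul_vertex_vertex, hΔ]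
      simp [Finsupp.single_apply]
    have hv := hvertex v v
    have hab := hvertex a b
    by_cases ha : a = v
    · subst ha
      by_cases hb : b = a
      · subst hb
        simpa using hv
      · simpa [hb, Ne.symm hb, eq_neg_iff_add_eq_zero, add_comm] using hab
    · by_cases hb : b = v
      · subst hb
        simp [ha]
      · simpa [ha, hb, Finsupp.single_apply] using hv.symm

section CoalgebraMaps

variable {k E}
variable {f : DigraphCoalgebraCarrier k E →ₗ[k] DigraphCoalgebraCarrier k E}

theorem exists_vertexMap (hf : Function.Injective f)
    (hcomul : ∀ c, digraphComul k E (f c) = TensorProduct.map f f (digraphComul k E c)) :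
    ∃ s : V → V, ∀ v, f (Finsupp.single (Sum.inl v) 1) = Finsupp.single (Sum.inl (s v)) 1 := by
  refine Classical.skolem.mp fun v => exists_eq_vertex_of_groupLike k E _ ?_ ?_
  · rw [Ne, map_eq_zero_iff f hf]
    simp
  · rw [hcomul, digraphComul_vertex, TensorProduct.map_tmul]

theorem exists_map_edge (hf : Function.Injective f)
    (hcomul : ∀ c, digraphComul k E (f c) = TensorProduct.map f f (digraphComul k E c))
    {s : V → V}
    (hs : ∀ v, f (Finsupp.single (Sum.inl v) 1) = Finsupp.single (Sum.inl (s v)) 1) (e : ↥E) :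
    ∃ (h : (s e.1.1, s e.1.2) ∈ E) (l : k) (m : kˣ),
      f (Finsupp.single (Sum.inr e) 1) =
        l • (Finsupp.single (Sum.inl (s e.1.2)) 1 - Finsupp.single (Sum.inl (s e.1.1)) 1) +
          (m : k) • Finsupp.single (Sum.inr ⟨_, h⟩) 1 := by
  classical
  set c := f (Finsupp.single (Sum.inr e) 1) with hc
  obtain ⟨hedge, hvertex⟩ := skewPrimitive_eq k E (s e.1.1) (s e.1.2) c (by
    rw [hcomul, digraphComul_edge, map_add, TensorProduct.map_tmul, TensorProduct.map_tmul,
      hs, hs])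
  have hne : ∃ e' : ↥E, c (Sum.inr e') ≠ 0 := by
    by_contra! hzero
    have hcv : c = f (c (Sum.inl (s e.1.2)) •
        (Finsupp.single (Sum.inl e.1.2) 1 - Finsupp.single (Sum.inl e.1.1) 1)) := by
      rw [map_smul, map_sub, hs, hs]
      ext (v | e')
      · exact hvertex v
      · simp [hzero]
    have := DFunLike.congr_fun (hf hcv) (Sum.inr e)
    simp at this
  obtain ⟨⟨p, hp⟩, hne⟩ := hne
  obtain rfl : p = _ := hedge _ hne
  refine ⟨hp, c (Sum.inl (s e.1.2)), Units.mk0 _ hne, ?_⟩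
  ext (v | e')
  · rw [hvertex v]
    simp
  · by_cases h : e' = ⟨_, hp⟩
    · subst h
      simp
    · have : c (Sum.inr e') = 0 := by
        by_contra h'
        exact h (Subtype.ext (hedge e' h'))
      simp [this, Ne.symm h]

end CoalgebraMaps

theorem stmt3 (f : DigraphCoalgebraCarrier k E ≃ₗ[k] DigraphCoalgebraCarrier k E)
    (hcounit : ∀ c : DigraphCoalgebraCarrier k E, digraphCounit k E (f c) = digraphCounit k E c)
    (hcomul : ∀ c : DigraphCoalgebraCarrier k E,
      digraphComul k E (f c) =
        TensorProduct.map f.toLinearMap f.toLinearMap (digraphComul k E c)) :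
    ∃ (σ : V ≃ V) (hσ : ∀ v w : V, (v, w) ∈ E ↔ (σ v, σ w) ∈ E)
      (lam : ↥E → k) (mu : ↥E → kˣ),
      f.toLinearMap = fAut k E σ hσ lam mu := by
  have hcomul' (c : DigraphCoalgebraCarrier k E) : digraphComul k E (f.symm.toLinearMap c) =
      TensorProduct.map f.symm.toLinearMap f.symm.toLinearMap (digraphComul k E c) := by
    obtain ⟨d, rfl⟩ := f.surjective c
    rw [hcomul, ← LinearMap.comp_apply (TensorProduct.map _ _), ← TensorProduct.map_comp]
    simp
  obtain ⟨s, hs⟩ := exists_vertexMap (f := f.toLinearMap) f.injective hcomul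
  obtain ⟨t, ht⟩ := exists_vertexMap (f := f.symm.toLinearMap) f.symm.injective hcomul'
  have hvertex : Function.Injective
      fun v : V => (Finsupp.single (Sum.inl v) 1 : DigraphCoalgebraCarrier k E) :=
    (Finsupp.single_left_injective one_ne_zero).comp Sum.inl_injective
  have hts (v : V) : t (s v) = v := hvertex <| by
    have := ht (s v)
    rw [← hs] at this
    simpa using this.symm
  have hst (v : V) : s (t v) = v := hvertex <| by
    have := hs (t v)
    rw [← ht] at this
    simpa using this.symm
  choose hmem lam mu hedge using exists_map_edge (f := f.toLinearMap) f.injective hcomul hs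
  have hσ (v w : V) : (v, w) ∈ E ↔ (s v, s w) ∈ E := by
    refine ⟨fun h => hmem ⟨_, h⟩, fun h => ?_⟩
    obtain ⟨h', -⟩ :=
      exists_map_edge (f := f.symm.toLinearMap) f.symm.injective hcomul' ht ⟨_, h⟩
    simpa [hts] using h'
  refine ⟨⟨s, t, hts, hst⟩, hσ, lam, mu, Finsupp.lhom_ext' fun x => LinearMap.ext_ring ?_⟩
  rcases x with v | e
  · simpa [fAut] using hs v
  · simpa [fAut, edgeMap] using hedge e
end

section
/- Let k be a field and let G be a group. There exists a k-coalgebra C such that Aut(C) ≅ K ⋊ G, where K is a direct product of copies of the semidirect product k ⋊ kˣ; moreover G is the image of the restriction homomorphism Aut(C) → Sym(G(C)) to the set of grouplike elements of C. -/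
open TensorProduct

universe u v w

/-- A bundled `k`-coalgebra. -/
structure BundledCoalgebra.{w', u'} (k : Type u') [Field k] : Type (max u' (w' + 1)) where
  carrier : Type w'
  [addCommGroup : AddCommGroup carrier]
  [module : Module k carrier]
  [coalgebra : Coalgebra k carrier]

attribute [instance] BundledCoalgebra.addCommGroup BundledCoalgebra.module
  BundledCoalgebra.coalgebra

variable (k : Type u) [Field k]

/-- The group of coalgebra automorphisms of a `k`-coalgebra `C`, as a subgroup of the linear
automorphisms of `C`: the bijective linear maps `f` with `ε ∘ f = ε` and
`Δ ∘ f = (f ⊗ f) ∘ Δ`. -/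
noncomputable def coalgAut (C : Type w) [AddCommGroup C] [Module k C] [Coalgebra k C] :
    Subgroup (C ≃ₗ[k] C) where
  carrier := {f | (∀ c, Coalgebra.counit (R := k) (f c) = Coalgebra.counit (R := k) c) ∧
    ∀ c, Coalgebra.comul (R := k) (f c) =
      TensorProduct.map f.toLinearMap f.toLinearMap (Coalgebra.comul c)}
  one_mem' := by
    refine ⟨fun c => rfl, fun c => ?_⟩
    show Coalgebra.comul c = TensorProduct.map LinearMap.id LinearMap.id (Coalgebra.comul c)
    rw [TensorProduct.map_id, LinearMap.id_apply]
  mul_mem' := by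
    rintro f g ⟨hf1, hf2⟩ ⟨hg1, hg2⟩
    refine ⟨fun c => ?_, fun c => ?_⟩
    · show Coalgebra.counit (R := k) (f (g c)) = _
      rw [hf1, hg1]
    · show Coalgebra.comul (R := k) (f (g c)) =
        TensorProduct.map (f.toLinearMap ∘ₗ g.toLinearMap)
          (f.toLinearMap ∘ₗ g.toLinearMap) (Coalgebra.comul c)
      rw [hf2, hg2, TensorProduct.map_comp, LinearMap.comp_apply]
  inv_mem' := by
    rintro f ⟨hf1, hf2⟩
    have key : ∀ x, TensorProduct.map f.symm.toLinearMap f.symm.toLinearMap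
        (TensorProduct.map f.toLinearMap f.toLinearMap x) = x := by
      intro x
      rw [← LinearMap.comp_apply, ← TensorProduct.map_comp]
      have h : f.symm.toLinearMap ∘ₗ f.toLinearMap = (LinearMap.id : C →ₗ[k] C) := by
        ext y
        simp
      rw [h, TensorProduct.map_id, LinearMap.id_apply]
    refine ⟨fun c => ?_, fun c => ?_⟩
    · have h := hf1 (f.symm c)
      rw [f.apply_symm_apply] at h
      exact h.symm
    · have h := hf2 (f.symm c)
      rw [f.apply_symm_apply] at h
      show Coalgebra.comul (R := k) (f.symm c) =
        TensorProduct.map f.symm.toLinearMap f.symm.toLinearMap (Coalgebra.comul c)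
      rw [h, key]

/-- The set of grouplike elements of a `k`-coalgebra `C`. -/
def grouplikes (C : Type w) [AddCommGroup C] [Module k C] [Coalgebra k C] : Set C :=
  {c | Coalgebra.comul (R := k) c = c ⊗ₜ[k] c ∧ Coalgebra.counit (R := k) c = 1}

/-- The action of `kˣ` on the additive group of `k` by multiplication, as a homomorphism
into the automorphisms of `Multiplicative k`. -/
def unitsMulAction : kˣ →* MulAut (Multiplicative k) where
  toFun u := AddEquiv.toMultiplicative (DistribMulAction.toAddAut kˣ k u)
  map_one' := by ext x; simp
  map_mul' u v := by ext x; simp [mul_smul]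

/-- The semidirect product `k ⋊ kˣ` of the additive group of `k` by the multiplicative
group `kˣ` acting by multiplication. -/
def AffGroup : Type u :=
  SemidirectProduct (Multiplicative k) kˣ (unitsMulAction k)

noncomputable instance : Group (AffGroup k) :=
  inferInstanceAs (Group (SemidirectProduct _ _ _))

namespace AffGroup

variable {k}

/-- The linear part of an element of `k ⋊ kˣ`. -/
def scale (x : AffGroup k) : kˣ := SemidirectProduct.right x

/-- The translation part of an element of `k ⋊ kˣ`. -/
def shift (x : AffGroup k) : k := Multiplicative.toAdd (SemidirectProduct.left x)

/-- The element of `k ⋊ kˣ` with given translation part and linear part. -/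
def mk (b : k) (a : kˣ) : AffGroup k := SemidirectProduct.mk (Multiplicative.ofAdd b) a

@[simp] lemma scale_one : scale (1 : AffGroup k) = 1 := rfl

@[simp] lemma shift_one : shift (1 : AffGroup k) = 0 := rfl

@[simp] lemma scale_mk (b : k) (a : kˣ) : scale (mk b a) = a := rfl

@[simp] lemma shift_mk (b : k) (a : kˣ) : shift (mk b a) = b := rfl

@[simp] lemma scale_mul (x y : AffGroup k) : scale (x * y) = scale x * scale y := rfl

@[simp] lemma shift_mul (x y : AffGroup k) : shift (x * y) = shift x + scale x * shift y := rfl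

lemma ext {x y : AffGroup k} (h₁ : shift x = shift y) (h₂ : scale x = scale y) : x = y :=
  SemidirectProduct.ext h₁ h₂

end AffGroup

/-- A homomorphism from a group into the endomorphisms of a coalgebra that respect the coalgebra
structure, regarded as a homomorphism into the automorphism group. -/
noncomputable def toCoalgAut {C : Type w} [AddCommGroup C] [Module k C] [Coalgebra k C]
    {H : Type*} [Group H] (L : H →* Module.End k C)
    (hε : ∀ h, Coalgebra.counit (R := k) ∘ₗ L h = Coalgebra.counit)
    (hΔ : ∀ h, Coalgebra.comul (R := k) ∘ₗ L h =
      TensorProduct.map (L h) (L h) ∘ₗ Coalgebra.comul) :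
    H →* coalgAut k C :=
  ((LinearMap.GeneralLinearGroup.generalLinearEquiv k C).toMonoidHom.comp
    L.toHomUnits).codRestrict (coalgAut k C) fun h =>
      ⟨fun c => LinearMap.congr_fun (hε h) c, fun c => LinearMap.congr_fun (hΔ h) c⟩

lemma coalgAut_apply_mem_grouplikes {C : Type w} [AddCommGroup C] [Module k C] [Coalgebra k C]
    (f : coalgAut k C) {c : C} (hc : c ∈ grouplikes k C) :
    f.1 c ∈ grouplikes k C :=
  ⟨by rw [f.2.2, hc.1]; rfl, by rw [f.2.1, hc.2]⟩

/-- The action of the coalgebra automorphisms on the grouplike elements. -/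
noncomputable def grouplikeAction (C : Type w) [AddCommGroup C] [Module k C] [Coalgebra k C] :
    coalgAut k C →* Equiv.Perm (grouplikes k C) :=
  MonoidHom.toHomPerm
    { toFun := fun f c => ⟨f.1 c, coalgAut_apply_mem_grouplikes k f c.2⟩
      map_one' := rfl
      map_mul' := fun _ _ => rfl }

@[simp] lemma grouplikeAction_apply {C : Type w} [AddCommGroup C] [Module k C] [Coalgebra k C]
    (f : coalgAut k C) (c : grouplikes k C) : (grouplikeAction k C f c : C) = f.1 c := rfl

section Digraph

variable {V : Type w} (r : V → V → Prop)

/-- The edges of a digraph. -/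
abbrev DigraphEdge : Type w := {p : V × V // r p.1 p.2}

/-- The vector space on the vertices and the edges of a digraph. -/
def DigraphCoalgebra : Type max u w := (V ⊕ DigraphEdge r) →₀ k

namespace DigraphCoalgebra

noncomputable instance : AddCommGroup (DigraphCoalgebra k r) :=
  inferInstanceAs (AddCommGroup (_ →₀ k))

noncomputable instance : Module k (DigraphCoalgebra k r) :=
  inferInstanceAs (Module k (_ →₀ k))

/-- The basis of vertices and edges. -/
noncomputable def basis : Module.Basis (V ⊕ DigraphEdge r) k (DigraphCoalgebra k r) :=
  .ofRepr (LinearEquiv.refl k _)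

/-- The basis element of a vertex. -/
noncomputable def vertex (v : V) : DigraphCoalgebra k r := basis k r (.inl v)

/-- The basis element of an edge. -/
noncomputable def edge (e : DigraphEdge r) : DigraphCoalgebra k r := basis k r (.inr e)

variable {k r} in
lemma hom_ext {M : Type*} [AddCommMonoid M] [Module k M] {f g : DigraphCoalgebra k r →ₗ[k] M}
    (hv : ∀ v, f (vertex k r v) = g (vertex k r v)) (he : ∀ e, f (edge k r e) = g (edge k r e)) :
    f = g :=
  (basis k r).ext (Sum.rec hv he)

/-- The linear map with given values on vertices and on edges. -/
noncomputable def lift {M : Type*} [AddCommMonoid M] [Module k M] (p : V → M)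
    (q : DigraphEdge r → M) : DigraphCoalgebra k r →ₗ[k] M :=
  (basis k r).constr k (Sum.elim p q)

@[simp] lemma lift_vertex {M : Type*} [AddCommMonoid M] [Module k M] (p : V → M)
    (q : DigraphEdge r → M) (v : V) : lift k r p q (vertex k r v) = p v := by
  simp [lift, vertex]

@[simp] lemma lift_edge {M : Type*} [AddCommMonoid M] [Module k M] (p : V → M)
    (q : DigraphEdge r → M) (e : DigraphEdge r) : lift k r p q (edge k r e) = q e := by
  simp [lift, edge]

/-- Vertices are grouplike, and an edge is skew-primitive with respect to its ends. -/
noncomputable instance : CoalgebraStruct k (DigraphCoalgebra k r) where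
  comul := lift k r (fun v => vertex k r v ⊗ₜ vertex k r v)
    (fun e => vertex k r e.1.1 ⊗ₜ edge k r e + edge k r e ⊗ₜ vertex k r e.1.2)
  counit := lift k r (fun _ => 1) (fun _ => 0)

@[simp] lemma comul_vertex (v : V) :
    CoalgebraStruct.comul (R := k) (vertex k r v) = vertex k r v ⊗ₜ vertex k r v :=
  lift_vertex k r _ _ v

@[simp] lemma comul_edge (e : DigraphEdge r) :
    CoalgebraStruct.comul (R := k) (edge k r e) =
      vertex k r e.1.1 ⊗ₜ edge k r e + edge k r e ⊗ₜ vertex k r e.1.2 :=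
  lift_edge k r _ _ e

@[simp] lemma counit_vertex (v : V) : CoalgebraStruct.counit (R := k) (vertex k r v) = 1 :=
  lift_vertex k r _ _ v

@[simp] lemma counit_edge (e : DigraphEdge r) :
    CoalgebraStruct.counit (R := k) (edge k r e) = 0 :=
  lift_edge k r _ _ e

noncomputable instance : Coalgebra k (DigraphCoalgebra k r) where
  coassoc := by
    apply hom_ext <;> intro <;> simp [TensorProduct.tmul_add, TensorProduct.add_tmul, add_assoc]
  rTensor_counit_comp_comul := by apply hom_ext <;> intro <;> simp
  lTensor_counit_comp_comul := by apply hom_ext <;> intro <;> simp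

lemma vertex_mem_grouplikes (v : V) : vertex k r v ∈ grouplikes k (DigraphCoalgebra k r) :=
  ⟨comul_vertex k r v, counit_vertex k r v⟩

/-- The coefficient of a vertex. -/
noncomputable def vcoord (v : V) : DigraphCoalgebra k r →ₗ[k] k := (basis k r).coord (.inl v)

/-- The coefficient of an edge. -/
noncomputable def ecoord (e : DigraphEdge r) : DigraphCoalgebra k r →ₗ[k] k :=
  (basis k r).coord (.inr e)

open Classical in
@[simp] lemma vcoord_vertex (v w : V) : vcoord k r v (vertex k r w) = if v = w then 1 else 0 := by
  simp [vcoord, vertex, Finsupp.single_apply, eq_comm]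

@[simp] lemma vcoord_edge (v : V) (e : DigraphEdge r) : vcoord k r v (edge k r e) = 0 := by
  simp [vcoord, edge]

@[simp] lemma ecoord_vertex (e : DigraphEdge r) (v : V) : ecoord k r e (vertex k r v) = 0 := by
  simp [ecoord, vertex]

open Classical in
@[simp] lemma ecoord_edge (e e' : DigraphEdge r) :
    ecoord k r e (edge k r e') = if e = e' then 1 else 0 := by
  simp [ecoord, edge, Finsupp.single_apply, eq_comm]

variable {k r} in
lemma ext_coord {x y : DigraphCoalgebra k r} (hv : ∀ v, vcoord k r v x = vcoord k r v y)
    (he : ∀ e, ecoord k r e x = ecoord k r e y) : x = y :=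
  (basis k r).ext_elem (Sum.rec hv he)

lemma vertex_injective : Function.Injective (vertex k r) := fun _ _ h =>
  Sum.inl_injective ((basis k r).injective h)

variable {k} in
/-- The product of two functionals as a functional on the tensor square. -/
noncomputable def tensorFunctional {C : Type*} [AddCommGroup C] [Module k C] (p q : C →ₗ[k] k) :
    C ⊗[k] C →ₗ[k] k :=
  LinearMap.mul' k k ∘ₗ TensorProduct.map p q

variable {k} in
@[simp] lemma tensorFunctional_tmul {C : Type*} [AddCommGroup C] [Module k C]
    (p q : C →ₗ[k] k) (x y : C) : tensorFunctional p q (x ⊗ₜ y) = p x * q y := by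
  simp [tensorFunctional]

open Classical in
lemma vcoord_vcoord_comul (v w : V) (x : DigraphCoalgebra k r) :
    tensorFunctional (vcoord k r v) (vcoord k r w) (CoalgebraStruct.comul (R := k) x) =
      if v = w then vcoord k r v x else 0 := by
  suffices h : tensorFunctional (vcoord k r v) (vcoord k r w) ∘ₗ CoalgebraStruct.comul (R := k) =
      (if v = w then 1 else 0 : k) • vcoord k r v by
    simpa [-ite_smul] using LinearMap.congr_fun h x
  apply hom_ext <;> intro z <;> simp [-ite_smul]
  grind

lemma ecoord_ecoord_comul (e e' : DigraphEdge r) (x : DigraphCoalgebra k r) :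
    tensorFunctional (ecoord k r e) (ecoord k r e') (CoalgebraStruct.comul (R := k) x) = 0 := by
  suffices h : tensorFunctional (ecoord k r e) (ecoord k r e') ∘ₗ
      CoalgebraStruct.comul (R := k) = 0 from LinearMap.congr_fun h x
  apply hom_ext <;> intro z <;> simp

open Classical in
lemma vcoord_ecoord_comul (v : V) (e : DigraphEdge r) (x : DigraphCoalgebra k r) :
    tensorFunctional (vcoord k r v) (ecoord k r e) (CoalgebraStruct.comul (R := k) x) =
      if v = e.1.1 then ecoord k r e x else 0 := by
  suffices h : tensorFunctional (vcoord k r v) (ecoord k r e) ∘ₗ CoalgebraStruct.comul (R := k) =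
      (if v = e.1.1 then 1 else 0 : k) • ecoord k r e by
    simpa [-ite_smul] using LinearMap.congr_fun h x
  apply hom_ext <;> intro z <;> simp [-ite_smul]
  grind

open Classical in
lemma ecoord_vcoord_comul (e : DigraphEdge r) (v : V) (x : DigraphCoalgebra k r) :
    tensorFunctional (ecoord k r e) (vcoord k r v) (CoalgebraStruct.comul (R := k) x) =
      if v = e.1.2 then ecoord k r e x else 0 := by
  suffices h : tensorFunctional (ecoord k r e) (vcoord k r v) ∘ₗ CoalgebraStruct.comul (R := k) =
      (if v = e.1.2 then 1 else 0 : k) • ecoord k r e by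
    simpa [-ite_smul] using LinearMap.congr_fun h x
  apply hom_ext <;> intro z <;> simp [-ite_smul]
  grind

variable {k r} in
/-- The grouplike elements are the vertices. -/
lemma exists_eq_vertex {c : DigraphCoalgebra k r}
    (hc : c ∈ grouplikes k (DigraphCoalgebra k r)) : ∃ v, c = vertex k r v := by
  classical
  obtain ⟨hΔ, hε⟩ := hc
  have he (e : DigraphEdge r) : ecoord k r e c = 0 := by
    have := ecoord_ecoord_comul k r e e c
    rw [hΔ, tensorFunctional_tmul] at this
    simpa using this
  have hv (v w : V) : vcoord k r v c * vcoord k r w c = if v = w then vcoord k r v c else 0 := by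
    rw [← vcoord_vcoord_comul, hΔ, tensorFunctional_tmul]
  obtain ⟨v, hv0⟩ : ∃ v, vcoord k r v c ≠ 0 := by
    by_contra! h
    have : c = 0 := ext_coord (by simpa using h) (by simpa using he)
    simp [this] at hε
  refine ⟨v, ext_coord (fun w => ?_) (by simpa using he)⟩
  rw [vcoord_vertex]
  have h1 := hv v w
  split_ifs at h1 ⊢ <;> grind

variable {k r} in
/-- Skew-primitive elements with respect to two distinct vertices. -/
lemma eq_of_comul_eq {a b : V} (hab : a ≠ b) {x : DigraphCoalgebra k r}
    (hx : CoalgebraStruct.comul (R := k) x = vertex k r a ⊗ₜ x + x ⊗ₜ vertex k r b) :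
    (∃ (h : r a b) (α β : k), x = α • edge k r ⟨(a, b), h⟩ + β • (vertex k r a - vertex k r b)) ∨
      ∃ β : k, x = β • (vertex k r a - vertex k r b) := by
  classical
  have hv (v w : V) : (if v = w then vcoord k r v x else 0) =
      (if v = a then 1 else 0) * vcoord k r w x + vcoord k r v x * if w = b then 1 else 0 := by
    rw [← vcoord_vcoord_comul, hx]; simp
  have h1 (v : V) (e : DigraphEdge r) : (if v = e.1.1 then ecoord k r e x else 0) =
      (if v = a then 1 else 0) * ecoord k r e x := by
    rw [← vcoord_ecoord_comul, hx]; simp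
  have h2 (v : V) (e : DigraphEdge r) : (if v = e.1.2 then ecoord k r e x else 0) =
      ecoord k r e x * (if v = b then 1 else 0) := by
    rw [← ecoord_vcoord_comul, hx]; simp
  have hv' (v : V) : vcoord k r v x =
      vcoord k r a x * ((if v = a then 1 else 0) - if v = b then 1 else 0) := by
    have e1 := hv v v
    have e2 := hv a b
    grind
  have he (e : DigraphEdge r) (h : ¬ (e.1.1 = a ∧ e.1.2 = b)) : ecoord k r e x = 0 := by
    have e1 := h1 e.1.1 e
    have e2 := h2 e.1.2 e
    grind
  by_cases hr : r a b
  · refine .inl ⟨hr, ecoord k r ⟨(a, b), hr⟩ x, vcoord k r a x, ext_coord (fun v => ?_)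
      fun e => ?_⟩
    · rw [hv']; simp
    · by_cases h : e = ⟨(a, b), hr⟩
      · subst h; simp
      · rw [he e (by grind)]; simp [h]
  · refine .inr ⟨vcoord k r a x, ext_coord (fun v => ?_) fun e => ?_⟩
    · rw [hv']; simp
    · rw [he e (by grind)]; simp

/-- Automorphisms of a digraph act on its edges. -/
instance : MulAction (r ≃r r) (DigraphEdge r) where
  smul σ e := ⟨(σ e.1.1, σ e.1.2), σ.map_rel_iff.2 e.2⟩
  one_smul _ := rfl
  mul_smul _ _ _ := rfl

variable {r} in
@[simp] lemma smul_edge_fst (σ : r ≃r r) (e : DigraphEdge r) : (σ • e).1.1 = σ e.1.1 := rfl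

variable {r} in
@[simp] lemma smul_edge_snd (σ : r ≃r r) (e : DigraphEdge r) : (σ • e).1.2 = σ e.1.2 := rfl

/-- Automorphisms of a digraph permute the basis. -/
noncomputable def permEnd : (r ≃r r) →* Module.End k (DigraphCoalgebra k r) where
  toFun σ := lift k r (fun v => vertex k r (σ v)) (fun e => edge k r (σ • e))
  map_one' := by apply hom_ext <;> intro <;> simp
  map_mul' σ τ := by apply hom_ext <;> intro <;> simp [mul_smul, RelIso.mul_apply]

@[simp] lemma permEnd_vertex (σ : r ≃r r) (v : V) :
    permEnd k r σ (vertex k r v) = vertex k r (σ v) := lift_vertex k r _ _ v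

@[simp] lemma permEnd_edge (σ : r ≃r r) (e : DigraphEdge r) :
    permEnd k r σ (edge k r e) = edge k r (σ • e) := lift_edge k r _ _ e

/-- A family in `k ⋊ kˣ` acts on the edges by rescaling and by adding a multiple of the difference
of the two ends. -/
noncomputable def affEnd : (DigraphEdge r → AffGroup k) →* Module.End k (DigraphCoalgebra k r) where
  toFun n := lift k r (vertex k r) (fun e => (((n e).scale⁻¹ : kˣ) : k) •
    (edge k r e - (n e).shift • (vertex k r e.1.1 - vertex k r e.1.2)))
  map_one' := by apply hom_ext <;> intro <;> simp
  map_mul' m n := by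
    apply hom_ext <;> intro e
    · simp
    · simp only [Pi.mul_apply, AffGroup.scale_mul, AffGroup.shift_mul, lift_edge, mul_inv,
        Units.val_mul, Module.End.mul_apply, map_smul, map_sub, lift_vertex]
      have h : (((m e).scale⁻¹ : kˣ) : k) * (m e).scale = 1 := Units.inv_mul _
      match_scalars <;> grind

@[simp] lemma affEnd_vertex (n : DigraphEdge r → AffGroup k) (v : V) :
    affEnd k r n (vertex k r v) = vertex k r v := lift_vertex k r _ _ v

@[simp] lemma affEnd_edge (n : DigraphEdge r → AffGroup k) (e : DigraphEdge r) :
    affEnd k r n (edge k r e) = (((n e).scale⁻¹ : kˣ) : k) •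
      (edge k r e - (n e).shift • (vertex k r e.1.1 - vertex k r e.1.2)) := lift_edge k r _ _ e

/-- Automorphisms of a digraph as coalgebra automorphisms. -/
noncomputable def permAut : (r ≃r r) →* coalgAut k (DigraphCoalgebra k r) :=
  toCoalgAut k (permEnd k r) (fun σ => by apply hom_ext <;> intro <;> simp)
    (fun σ => by apply hom_ext <;> intro <;> simp)

/-- Families in `k ⋊ kˣ` as coalgebra automorphisms. -/
noncomputable def affAut : (DigraphEdge r → AffGroup k) →* coalgAut k (DigraphCoalgebra k r) :=
  toCoalgAut k (affEnd k r) (fun n => by apply hom_ext <;> intro <;> simp)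
    (fun n => by
      apply hom_ext <;> intro e
      · simp
      · simp only [LinearMap.comp_apply, affEnd_edge, map_smul, map_sub, comul_edge, comul_vertex,
          map_add, TensorProduct.map_tmul, affEnd_vertex, ← TensorProduct.smul_tmul',
          TensorProduct.tmul_smul, TensorProduct.tmul_sub, TensorProduct.sub_tmul]
        module)

@[simp] lemma permAut_apply (σ : r ≃r r) (c : DigraphCoalgebra k r) :
    (permAut k r σ).1 c = permEnd k r σ c := rfl

@[simp] lemma affAut_apply (n : DigraphEdge r → AffGroup k) (c : DigraphCoalgebra k r) :
    (affAut k r n).1 c = affEnd k r n c := rfl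

variable {k r} in
lemma coalgAut_ext {f g : coalgAut k (DigraphCoalgebra k r)}
    (hv : ∀ v, f.1 (vertex k r v) =
      g.1 (vertex k r v))
    (he : ∀ e, f.1 (edge k r e) =
      g.1 (edge k r e)) : f = g :=
  Subtype.ext (LinearEquiv.toLinearMap_injective (hom_ext hv he))

lemma affAut_smul (σ : r ≃r r) (n : DigraphEdge r → AffGroup k) :
    affAut k r (mulAutArrow σ n) = permAut k r σ * affAut k r n * (permAut k r σ)⁻¹ := by
  rw [eq_mul_inv_iff_mul_eq]
  apply coalgAut_ext <;> intro e
  · simp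
  · have h : mulAutArrow σ n (σ • e) = n e := congrArg n (inv_smul_smul σ e)
    simp [h, -mulAutArrow_apply_apply]

/-- The semidirect product of the families in `k ⋊ kˣ` by the digraph automorphisms, acting on the
coalgebra. -/
noncomputable def semidirectAut :
    (DigraphEdge r → AffGroup k) ⋊[mulAutArrow] (r ≃r r) →* coalgAut k (DigraphCoalgebra k r) :=
  SemidirectProduct.lift (affAut k r) (permAut k r) fun σ => by
    ext1 n
    simpa using affAut_smul k r σ n

lemma semidirectAut_apply (x : (DigraphEdge r → AffGroup k) ⋊[mulAutArrow] (r ≃r r)) :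
    semidirectAut k r x = affAut k r x.left * permAut k r x.right := rfl

lemma semidirectAut_vertex (x : (DigraphEdge r → AffGroup k) ⋊[mulAutArrow] (r ≃r r)) (v : V) :
    (semidirectAut k r x).1 (vertex k r v) =
      vertex k r (x.right v) := by
  simp [semidirectAut_apply]

lemma affAut_injective (hr : ∀ v, ¬ r v v) : Function.Injective (affAut k r) := by
  classical
  intro m n h
  funext e
  have h1 := congrArg (fun f => f.1 (edge k r e)) h
  simp only [affAut_apply, affEnd_edge] at h1
  have hne : e.1.1 ≠ e.1.2 := fun h => hr e.1.1 (by simpa [← h] using e.2)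
  have h2 : (m e).scale = (n e).scale := by
    simpa [Units.ext_iff] using congrArg (ecoord k r e) h1
  have h3 := congrArg (vcoord k r e.1.1) h1
  exact AffGroup.ext (by simpa [h2, hne] using h3) h2

lemma semidirectAut_injective (hr : ∀ v, ¬ r v v) : Function.Injective (semidirectAut k r) := by
  rw [injective_iff_map_eq_one]
  intro x hx
  have h1 : x.right = 1 := by
    ext v
    apply vertex_injective k r
    rw [← semidirectAut_vertex, hx]
    rfl
  rw [semidirectAut_apply, h1, map_one, mul_one] at hx
  exact SemidirectProduct.ext (affAut_injective k r hr (hx.trans (map_one _).symm)) h1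

variable {k r} in
lemma exists_vertex_map (f : coalgAut k (DigraphCoalgebra k r)) :
    ∃ s : V → V, ∀ v, f.1 (vertex k r v) = vertex k r (s v) :=
  ⟨_, fun v => (exists_eq_vertex
    (coalgAut_apply_mem_grouplikes k f (vertex_mem_grouplikes k r v))).choose_spec⟩

variable {k r} in
lemma exists_edge_map (hr : ∀ v, ¬ r v v) (f : coalgAut k (DigraphCoalgebra k r)) {s : V → V}
    (hs : ∀ v, f.1 (vertex k r v) = vertex k r (s v))
    (hinj : Function.Injective s) (e : DigraphEdge r) :
    ∃ (h : r (s e.1.1) (s e.1.2)) (α : kˣ) (β : k),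
      f.1 (edge k r e) = (α : k) • edge k r ⟨(_, _), h⟩ +
        β • (vertex k r (s e.1.1) - vertex k r (s e.1.2)) := by
  have hne : e.1.1 ≠ e.1.2 := fun h => hr e.1.1 (by simpa [← h] using e.2)
  have key (β : k) : f.1 (edge k r e) ≠
      β • (vertex k r (s e.1.1) - vertex k r (s e.1.2)) := by
    classical
    intro h
    rw [← hs, ← hs, ← map_sub, ← map_smul] at h
    simpa using congrArg (ecoord k r e) (f.1.injective h)
  have hΔ := f.2.2 (edge k r e)
  rw [comul_edge, map_add, TensorProduct.map_tmul, TensorProduct.map_tmul] at hΔ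
  simp only [LinearEquiv.coe_coe, hs] at hΔ
  obtain ⟨h, α, β, hx⟩ | ⟨β, hx⟩ := eq_of_comul_eq (hinj.ne hne) hΔ
  · have hα : α ≠ 0 := by
      rintro rfl
      exact key β (by simpa using hx)
    exact ⟨h, Units.mk0 α hα, β, hx⟩
  · exact absurd hx (key β)

lemma semidirectAut_surjective (hr : ∀ v, ¬ r v v) : Function.Surjective (semidirectAut k r) := by
  intro f
  obtain ⟨s, hs⟩ := exists_vertex_map f
  obtain ⟨t, ht⟩ := exists_vertex_map f⁻¹
  have hst (v : V) : s (t v) = v := by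
    apply vertex_injective k r
    rw [← hs, ← ht]
    exact f.1.apply_symm_apply _
  have hts (v : V) : t (s v) = v := by
    apply vertex_injective k r
    rw [← ht, ← hs]
    exact f.1.symm_apply_apply _
  have hes := exists_edge_map hr f hs (Function.LeftInverse.injective hts)
  have het := exists_edge_map hr f⁻¹ ht (Function.LeftInverse.injective hst)
  let σ : r ≃r r :=
    { toFun := s
      invFun := t
      left_inv := hts
      right_inv := hst
      map_rel_iff' := fun {a b} => ⟨fun h => by simpa [hts] using (het ⟨(s a, s b), h⟩).1,
        fun h => (hes ⟨(a, b), h⟩).1⟩ }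
  have hes' := hes
  choose h α β hf using hes'
  refine ⟨⟨fun e => AffGroup.mk (-(β (σ⁻¹ • e) * ((α (σ⁻¹ • e))⁻¹ : kˣ))) (α (σ⁻¹ • e))⁻¹, σ⟩, ?_⟩
  apply coalgAut_ext
  · intro v
    rw [semidirectAut_vertex, hs]
    rfl
  · intro e
    rw [hf, semidirectAut_apply]
    have h1 : (α e : k) * ((α e)⁻¹ : kˣ) = 1 := Units.mul_inv _
    have h2 : (⟨(s e.1.1, s e.1.2), h e⟩ : DigraphEdge r) = σ • e := rfl
    have h3 (v : V) : σ v = s v := rfl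
    rw [h2]
    simp only [Subgroup.coe_mul, LinearEquiv.mul_apply, permAut_apply, affAut_apply, permEnd_edge,
      affEnd_edge, inv_smul_smul, AffGroup.scale_mk, AffGroup.shift_mk, inv_inv, smul_edge_fst,
      smul_edge_snd, h3]
    match_scalars <;> grind

/-- The automorphism group of the coalgebra of a loopless digraph. -/
noncomputable def autEquiv (hr : ∀ v, ¬ r v v) :
    (DigraphEdge r → AffGroup k) ⋊[mulAutArrow] (r ≃r r) ≃* coalgAut k (DigraphCoalgebra k r) :=
  MulEquiv.ofBijective (semidirectAut k r)
    ⟨semidirectAut_injective k r hr, semidirectAut_surjective k r hr⟩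

lemma grouplikeAction_permAut_injective :
    Function.Injective ((grouplikeAction k (DigraphCoalgebra k r)).comp (permAut k r)) := by
  intro σ τ h
  ext v
  apply vertex_injective k r
  simpa using congrArg Subtype.val (DFunLike.congr_fun h ⟨_, vertex_mem_grouplikes k r v⟩)

lemma range_grouplikeAction (hr : ∀ v, ¬ r v v) :
    (grouplikeAction k (DigraphCoalgebra k r)).range =
      ((grouplikeAction k (DigraphCoalgebra k r)).comp (permAut k r)).range := by
  apply le_antisymm
  · rintro _ ⟨f, rfl⟩
    obtain ⟨x, rfl⟩ := semidirectAut_surjective k r hr f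
    refine ⟨x.right, Equiv.ext fun ⟨c, hc⟩ => Subtype.ext ?_⟩
    obtain ⟨v, rfl⟩ := exists_eq_vertex hc
    exact (permEnd_vertex k r _ v).trans (semidirectAut_vertex k r x v).symm
  · rintro _ ⟨σ, rfl⟩
    exact ⟨_, rfl⟩

/-- The image of the action on grouplike elements is the automorphism group of the digraph. -/
noncomputable def rangeGrouplikeActionEquiv (hr : ∀ v, ¬ r v v) :
    (grouplikeAction k (DigraphCoalgebra k r)).range ≃* (r ≃r r) :=
  (MulEquiv.subgroupCongr (range_grouplikeAction k r hr)).trans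
    (MonoidHom.ofInjective (grouplikeAction_permAut_injective k r)).symm

end DigraphCoalgebra

end Digraph

/-- The vertices of a digraph encoding the Cayley table of a group: the group elements, the ordered
pairs, and a colour for each element. -/
inductive CayleyVertex (G : Type w) : Type w
  | elt (x : G)
  | pair (x y : G)
  | color (g : G)

namespace CayleyVertex

variable {G : Type w} [Group G]

/-- The pair `(x, y)` is linked from `x`, to `y`, and to the colour `x⁻¹ * y`; the colours are
well-ordered. -/
def Adj : CayleyVertex G → CayleyVertex G → Prop
  | elt x, pair a _ => a = x
  | pair _ b, elt y => b = y
  | pair a b, color g => a⁻¹ * b = g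
  | color g, color h => WellOrderingRel h g
  | _, _ => False

lemma adj_irrefl (v : CayleyVertex G) : ¬ Adj v v := by
  cases v with
  | elt => exact id
  | pair => exact id
  | color g => exact irrefl_of WellOrderingRel g

lemma exists_adj_ne_color {v : CayleyVertex G} (hv : ∀ g, v ≠ color g) :
    ∃ w, Adj v w ∧ (∀ g, w ≠ color g) := by
  cases v with
  | elt x => exact ⟨pair x x, rfl, by simp⟩
  | pair a b => exact ⟨elt b, rfl, by simp⟩
  | color g => exact absurd rfl (hv g)

/-- Colours are fixed by automorphisms: they form the well-founded part of the digraph, and a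
well-order is rigid. -/
lemma apply_color (σ : Adj (G := G) ≃r Adj (G := G)) (g : G) : σ (color g) = color g := by
  induction g using (WellOrderingRel.isWellOrder (α := G)).wf.induction with
  | _ g ih =>
    have hout (w : CayleyVertex G) (hw : Adj (σ (color g)) w) :
        ∃ h, WellOrderingRel h g ∧ w = color h := by
      have h1 : Adj (color g) (σ.symm w) := by
        rw [← σ.map_rel_iff]; simpa using hw
      cases h2 : σ.symm w with
      | color h =>
        rw [h2] at h1
        exact ⟨h, h1, by rw [← ih h h1, ← h2, RelIso.apply_symm_apply]⟩
      | elt x => rw [h2] at h1; exact h1.elim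
      | pair x y => rw [h2] at h1; exact h1.elim
    obtain ⟨h, hh⟩ : ∃ h, σ (color g) = color h := by
      by_contra! hne
      obtain ⟨w, hw, hw'⟩ := exists_adj_ne_color hne
      obtain ⟨h, -, rfl⟩ := hout w hw
      exact hw' h rfl
    rw [hh] at hout ⊢
    rcases trichotomous_of WellOrderingRel h g with hlt | rfl | hgt
    · rw [← ih h hlt] at hh
      exact (σ.injective hh).symm ▸ rfl
    · rfl
    · obtain ⟨j, hj, hj'⟩ := hout (color g) hgt
      cases hj'
      exact absurd hj (irrefl_of _ _)

lemma exists_apply_elt (σ : Adj (G := G) ≃r Adj (G := G)) (x : G) : ∃ y, σ (elt x) = elt y := by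
  cases h : σ (elt x) with
  | elt y => exact ⟨y, rfl⟩
  | color g =>
    rw [← apply_color σ g] at h
    cases σ.injective h
  | pair a b =>
    have h1 : Adj (σ (elt x)) (σ (color (a⁻¹ * b))) := by rw [h, apply_color]; rfl
    exact (σ.map_rel_iff.1 h1).elim

lemma apply_pair (σ : Adj (G := G) ≃r Adj (G := G)) {x y x' y' : G} (hx : σ (elt x) = elt x')
    (hy : σ (elt y) = elt y') : σ (pair x y) = pair x' y' := by
  have h1 : Adj (σ (elt x)) (σ (pair x y)) := σ.map_rel_iff.2 rfl
  have h2 : Adj (σ (pair x y)) (σ (elt y)) := σ.map_rel_iff.2 rfl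
  rw [hx] at h1
  rw [hy] at h2
  cases h : σ (pair x y) with
  | elt _ => rw [h] at h1; exact h1.elim
  | color _ => rw [h] at h1; exact h1.elim
  | pair a b =>
    rw [h] at h1 h2
    cases h1
    cases h2
    rfl

lemma inv_mul_eq_of_apply_elt (σ : Adj (G := G) ≃r Adj (G := G)) {x y x' y' : G}
    (hx : σ (elt x) = elt x') (hy : σ (elt y) = elt y') : x'⁻¹ * y' = x⁻¹ * y := by
  have h : Adj (σ (pair x y)) (σ (color (x⁻¹ * y))) := σ.map_rel_iff.2 rfl
  rwa [apply_pair σ hx hy, apply_color] at h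

/-- Left translation on the vertices. -/
instance : MulAction G (CayleyVertex G) where
  smul g
    | elt x => elt (g * x)
    | pair x y => pair (g * x) (g * y)
    | color h => color h
  one_smul v := by
    cases v with
    | elt x => exact congrArg elt (one_mul x)
    | pair x y => exact congrArg₂ pair (one_mul x) (one_mul y)
    | color h => rfl
  mul_smul a b v := by
    cases v with
    | elt x => exact congrArg elt (mul_assoc a b x)
    | pair x y => exact congrArg₂ pair (mul_assoc a b x) (mul_assoc a b y)
    | color h => rfl

@[simp] lemma smul_elt (g x : G) : g • elt x = elt (g * x) := rfl

@[simp] lemma smul_pair (g x y : G) : g • pair x y = pair (g * x) (g * y) := rfl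

@[simp] lemma smul_color (g h : G) : g • color h = color h := rfl

lemma adj_smul_iff (g : G) (v w : CayleyVertex G) : Adj (g • v) (g • w) ↔ Adj v w := by
  cases v <;> cases w <;> simp [Adj, mul_assoc]

variable (G) in
/-- Left translations as digraph automorphisms. -/
def translation : G →* (Adj (G := G) ≃r Adj (G := G)) where
  toFun g := ⟨MulAction.toPerm g, adj_smul_iff g _ _⟩
  map_one' := by ext v; exact one_smul G v
  map_mul' a b := by ext v; exact mul_smul a b v

lemma translation_apply (g : G) (v : CayleyVertex G) : translation G g v = g • v := rfl

lemma translation_injective : Function.Injective (translation G) := by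
  intro a b h
  simpa [translation_apply] using DFunLike.congr_fun h (elt 1)

lemma translation_surjective : Function.Surjective (translation G) := by
  intro σ
  obtain ⟨g, hg⟩ := exists_apply_elt σ 1
  have helt (x : G) : σ (elt x) = elt (g * x) := by
    obtain ⟨y, hy⟩ := exists_apply_elt σ x
    have := inv_mul_eq_of_apply_elt σ hg hy
    rw [hy, inv_mul_eq_iff_eq_mul.1 this, inv_one, one_mul]
  refine ⟨g, ?_⟩
  ext v
  cases v with
  | elt x => exact (helt x).symm
  | pair x y => exact (apply_pair σ (helt x) (helt y)).symm
  | color h => exact (apply_color σ h).symm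

variable (G) in
/-- Every group is the automorphism group of a loopless digraph. -/
noncomputable def translationEquiv : G ≃* (Adj (G := G) ≃r Adj (G := G)) :=
  MulEquiv.ofBijective (translation G) ⟨translation_injective, translation_surjective⟩

end CayleyVertex

theorem stmt8 (G : Type v) [Group G] :
    ∃ C : BundledCoalgebra.{max u v} k,
      (∃ (ι : Type (max u v)) (φ : G →* MulAut ((_ : ι) → AffGroup k)),
        Nonempty (↥(coalgAut k C.carrier) ≃*
          SemidirectProduct ((_ : ι) → AffGroup k) G φ)) ∧
      ∃ π : ↥(coalgAut k C.carrier) →* Equiv.Perm ↥(grouplikes k C.carrier),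
        (∀ (f : ↥(coalgAut k C.carrier)) (c : ↥(grouplikes k C.carrier)),
          ((π f c : ↥(grouplikes k C.carrier)) : C.carrier) =
            (f : C.carrier ≃ₗ[k] C.carrier) c) ∧
        Nonempty (π.range ≃* G) := by
  let r := CayleyVertex.Adj (G := ULift.{u} G)
  have hr : ∀ v, ¬ r v v := CayleyVertex.adj_irrefl
  let ρ : (r ≃r r) ≃* G := (CayleyVertex.translationEquiv _).symm.trans MulEquiv.ulift
  refine ⟨⟨DigraphCoalgebra k r⟩, ⟨DigraphEdge r, _,
    ⟨(DigraphCoalgebra.autEquiv k r hr).symm.trans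
      (SemidirectProduct.congr' (MulEquiv.refl _) ρ)⟩⟩,
    grouplikeAction k (DigraphCoalgebra k r), fun _ _ => rfl,
    ⟨(DigraphCoalgebra.rangeGrouplikeActionEquiv k r hr).trans ρ⟩⟩
end

section
/- Let G be a group, k a field, and ρ : G → Sym(V) a permutation representation of G on a set V. There exists a k-coalgebra C equipped with an action of G by coalgebra automorphisms such that: (1) the action is faithful, i.e., it induces an injective group homomorphism G → Aut(C); (2) the image of the restriction homomorphism Aut(C) → Sym(G(C)) is (isomorphic to) G; (3) there is a subset V ⊆ G(C) invariant under the action of Aut(C) such that ρ equals the composition of the inclusion G → Aut(C) with the restriction Aut(C) → Sym(V); and (4) there is a faithful action ρ̄ : G → Sym(G(C) ∖ V) such that the composition of the inclusion G → Aut(C) with the restriction Aut(C) → Sym(G(C)) is ρ ⊕ ρ̄. -/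
open TensorProduct

universe u v w

variable (k : Type u) [Field k]

/-! ### The coalgebra of a quiver -/

/-- The coalgebra of the quiver with vertices `X`, edges `E`, source `s` and target `t`: it has
basis `X ⊕ E`, vertices are grouplike and an edge `e` has
`Δ e = s e ⊗ e + e ⊗ t e` and `ε e = 0`. -/
def QuiverCoalgebra {X E : Type v} (_s _t : E → X) : Type (max u v) := (X ⊕ E) →₀ k

namespace QuiverCoalgebra

variable {k} {X E : Type v} {s t : E → X}

noncomputable instance : AddCommGroup (QuiverCoalgebra k s t) :=
  inferInstanceAs (AddCommGroup ((X ⊕ E) →₀ k))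

noncomputable instance : Module k (QuiverCoalgebra k s t) :=
  inferInstanceAs (Module k ((X ⊕ E) →₀ k))

variable (k s t) in
/-- The basis of the quiver coalgebra consisting of vertices and edges. -/
noncomputable def basis : Module.Basis (X ⊕ E) k (QuiverCoalgebra k s t) :=
  Module.Basis.ofRepr (LinearEquiv.refl k ((X ⊕ E) →₀ k))

variable (k s t) in
/-- A vertex, as an element of the quiver coalgebra. -/
noncomputable def vert (x : X) : QuiverCoalgebra k s t := basis k s t (Sum.inl x)

variable (k s t) in
/-- An edge, as an element of the quiver coalgebra. -/
noncomputable def edge (e : E) : QuiverCoalgebra k s t := basis k s t (Sum.inr e)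

theorem linearMap_ext {M : Type*} [AddCommGroup M] [Module k M]
    {f g : QuiverCoalgebra k s t →ₗ[k] M} (hv : ∀ x, f (vert k s t x) = g (vert k s t x))
    (he : ∀ e, f (edge k s t e) = g (edge k s t e)) : f = g :=
  (basis k s t).ext fun b => b.casesOn hv he

noncomputable instance : CoalgebraStruct k (QuiverCoalgebra k s t) where
  comul := (basis k s t).constr k (Sum.elim (fun x => vert k s t x ⊗ₜ vert k s t x)
    (fun e => vert k s t (s e) ⊗ₜ edge k s t e + edge k s t e ⊗ₜ vert k s t (t e)))
  counit := (basis k s t).constr k (Sum.elim (fun _ => (1 : k)) (fun _ => 0))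

@[simp]
theorem comul_vert (x : X) :
    Coalgebra.comul (R := k) (vert k s t x) = vert k s t x ⊗ₜ vert k s t x :=
  (basis k s t).constr_basis k _ _

@[simp]
theorem comul_edge (e : E) :
    Coalgebra.comul (R := k) (edge k s t e) =
      vert k s t (s e) ⊗ₜ edge k s t e + edge k s t e ⊗ₜ vert k s t (t e) :=
  (basis k s t).constr_basis k _ _

@[simp]
theorem counit_vert (x : X) : Coalgebra.counit (R := k) (vert k s t x) = 1 :=
  (basis k s t).constr_basis k _ _

@[simp]
theorem counit_edge (e : E) : Coalgebra.counit (R := k) (edge k s t e) = 0 :=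
  (basis k s t).constr_basis k _ _

noncomputable instance : Coalgebra k (QuiverCoalgebra k s t) where
  coassoc := by
    refine linearMap_ext (fun x => ?_) (fun e => ?_)
    · simp
    · simp [TensorProduct.add_tmul, TensorProduct.tmul_add, add_assoc]
  rTensor_counit_comp_comul := by
    refine linearMap_ext (fun x => ?_) (fun e => ?_) <;> simp
  lTensor_counit_comp_comul := by
    refine linearMap_ext (fun x => ?_) (fun e => ?_) <;> simp

/-! ### Coefficients -/

theorem repr_vert (x : X) : (basis k s t).repr (vert k s t x) = Finsupp.single (Sum.inl x) 1 :=
  (basis k s t).repr_self _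

theorem repr_edge (e : E) : (basis k s t).repr (edge k s t e) = Finsupp.single (Sum.inr e) 1 :=
  (basis k s t).repr_self _

theorem vert_injective : Function.Injective (vert k s t) :=
  (basis k s t).injective.comp Sum.inl_injective

variable (k s t) in
/-- The coefficient of `a ⊗ b` in a tensor. -/
noncomputable def tensorCoeff (a b : X ⊕ E) :
    QuiverCoalgebra k s t ⊗[k] QuiverCoalgebra k s t →ₗ[k] k :=
  LinearMap.mul' k k ∘ₗ TensorProduct.map ((basis k s t).coord a) ((basis k s t).coord b)

@[simp]
theorem tensorCoeff_tmul (a b : X ⊕ E) (c d : QuiverCoalgebra k s t) :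
    tensorCoeff k s t a b (c ⊗ₜ d) = (basis k s t).repr c a * (basis k s t).repr d b := by
  simp [tensorCoeff]

theorem tensorCoeff_comul_vert_vert {x y : X} (h : x ≠ y) (c : QuiverCoalgebra k s t) :
    tensorCoeff k s t (Sum.inl x) (Sum.inl y) (Coalgebra.comul c) = 0 := by
  classical
  have : tensorCoeff k s t (Sum.inl x) (Sum.inl y) ∘ₗ Coalgebra.comul = 0 := by
    refine linearMap_ext (fun z => ?_) (fun e => ?_)
    · simp only [LinearMap.comp_apply, comul_vert, tensorCoeff_tmul, repr_vert,
        Finsupp.single_apply, Sum.inl.injEq, LinearMap.zero_apply]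
      split_ifs <;> simp_all
    · simp [repr_vert, repr_edge]
  exact LinearMap.congr_fun this c

theorem tensorCoeff_comul_vert_self (x : X) (c : QuiverCoalgebra k s t) :
    tensorCoeff k s t (Sum.inl x) (Sum.inl x) (Coalgebra.comul c) =
      (basis k s t).repr c (Sum.inl x) := by
  classical
  have : tensorCoeff k s t (Sum.inl x) (Sum.inl x) ∘ₗ Coalgebra.comul =
      (basis k s t).coord (Sum.inl x) := by
    refine linearMap_ext (fun z => ?_) (fun e => ?_)
    · simp [repr_vert, Finsupp.single_apply]
    · simp [repr_vert, repr_edge]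
  exact LinearMap.congr_fun this c

theorem tensorCoeff_comul_edge_edge (e e' : E) (c : QuiverCoalgebra k s t) :
    tensorCoeff k s t (Sum.inr e) (Sum.inr e') (Coalgebra.comul c) = 0 := by
  have : tensorCoeff k s t (Sum.inr e) (Sum.inr e') ∘ₗ Coalgebra.comul = 0 := by
    refine linearMap_ext (fun z => ?_) (fun e => ?_) <;> simp [repr_vert, repr_edge]
  exact LinearMap.congr_fun this c

theorem tensorCoeff_comul_source (e : E) (c : QuiverCoalgebra k s t) :
    tensorCoeff k s t (Sum.inl (s e)) (Sum.inr e) (Coalgebra.comul c) =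
      (basis k s t).repr c (Sum.inr e) := by
  classical
  have : tensorCoeff k s t (Sum.inl (s e)) (Sum.inr e) ∘ₗ Coalgebra.comul =
      (basis k s t).coord (Sum.inr e) := by
    refine linearMap_ext (fun z => ?_) (fun e' => ?_)
    · simp [repr_vert]
    · by_cases h : e' = e <;> simp [repr_vert, repr_edge, Finsupp.single_apply, h]
  exact LinearMap.congr_fun this c

theorem tensorCoeff_comul_target (e : E) (c : QuiverCoalgebra k s t) :
    tensorCoeff k s t (Sum.inr e) (Sum.inl (t e)) (Coalgebra.comul c) =
      (basis k s t).repr c (Sum.inr e) := by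
  classical
  have : tensorCoeff k s t (Sum.inr e) (Sum.inl (t e)) ∘ₗ Coalgebra.comul =
      (basis k s t).coord (Sum.inr e) := by
    refine linearMap_ext (fun z => ?_) (fun e' => ?_)
    · simp [repr_vert]
    · by_cases h : e' = e <;> simp [repr_vert, repr_edge, Finsupp.single_apply, h]
  exact LinearMap.congr_fun this c

/-! ### Grouplike and skew-primitive elements -/

theorem eq_zero_of_repr {c : QuiverCoalgebra k s t}
    (hv : ∀ x, (basis k s t).repr c (Sum.inl x) = 0)
    (he : ∀ e, (basis k s t).repr c (Sum.inr e) = 0) : c = 0 :=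
  (basis k s t).ext_elem fun b => by
    rw [map_zero, Finsupp.zero_apply]
    exact b.casesOn hv he

theorem grouplikes_eq_range_vert :
    grouplikes k (QuiverCoalgebra k s t) = Set.range (vert k s t) := by
  classical
  refine Set.Subset.antisymm ?_ ?_
  · rintro c ⟨hΔ, hε⟩
    have he : ∀ e, (basis k s t).repr c (Sum.inr e) = 0 := fun e => by
      have h := tensorCoeff_comul_edge_edge e e c
      rw [hΔ, tensorCoeff_tmul] at h
      exact mul_self_eq_zero.mp h
    obtain ⟨x, hx⟩ : ∃ x, (basis k s t).repr c (Sum.inl x) ≠ 0 := by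
      by_contra! hv
      rw [eq_zero_of_repr hv he, map_zero] at hε
      exact zero_ne_one hε
    refine ⟨x, (basis k s t).ext_elem fun b => ?_⟩
    rw [repr_vert, Finsupp.single_apply]
    rcases b with y | e
    · by_cases hxy : x = y
      · subst hxy
        have h := tensorCoeff_comul_vert_self x c
        rw [hΔ, tensorCoeff_tmul] at h
        rw [if_pos rfl, mul_right_cancel₀ hx (h.trans (one_mul _).symm)]
      · have h := tensorCoeff_comul_vert_vert hxy c
        rw [hΔ, tensorCoeff_tmul] at h
        rw [if_neg (by simpa using hxy), (mul_eq_zero.mp h).resolve_left hx]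
    · simp [he e]
  · rintro _ ⟨x, rfl⟩
    exact ⟨comul_vert x, counit_vert x⟩

theorem edge_notMem_span_vert (e : E) :
    edge k s t e ∉ Submodule.span k (Set.range (vert k s t)) := by
  intro h
  have hle : Submodule.span k (Set.range (vert k s t)) ≤
      LinearMap.ker ((basis k s t).coord (Sum.inr e)) := by
    rw [Submodule.span_le]
    rintro _ ⟨x, rfl⟩
    simp [repr_vert]
  simpa [repr_edge] using hle h

theorem mem_span_vert {c : QuiverCoalgebra k s t}
    (he : ∀ e, (basis k s t).repr c (Sum.inr e) = 0) :
    c ∈ Submodule.span k (Set.range (vert k s t)) := by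
  rw [← (basis k s t).linearCombination_repr c, Finsupp.linearCombination_apply]
  refine Submodule.sum_mem _ fun b _ => ?_
  rcases b with x | e
  · exact Submodule.smul_mem _ _ (Submodule.subset_span ⟨x, rfl⟩)
  · simp [he e]

theorem exists_edge_iff (x y : X) :
    (∃ e, s e = x ∧ t e = y) ↔ ∃ c ∉ Submodule.span k (grouplikes k (QuiverCoalgebra k s t)),
      Coalgebra.comul (R := k) c = vert k s t x ⊗ₜ c + c ⊗ₜ vert k s t y := by
  classical
  rw [grouplikes_eq_range_vert]
  constructor
  · rintro ⟨e, rfl, rfl⟩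
    exact ⟨edge k s t e, edge_notMem_span_vert e, comul_edge e⟩
  · rintro ⟨c, hc, hΔ⟩
    by_contra! hxy
    refine hc (mem_span_vert fun e => ?_)
    by_contra hne
    refine hxy e ?_ ?_
    · by_contra hs
      have h := tensorCoeff_comul_source e c
      rw [hΔ] at h
      simp [repr_vert, Ne.symm hs] at h
      exact hne h.symm
    · by_contra ht
      have h := tensorCoeff_comul_target e c
      rw [hΔ] at h
      simp [repr_vert, Ne.symm ht] at h
      exact hne h.symm

end QuiverCoalgebra

/-! ### Automorphisms act on grouplike elements -/

section Grouplikes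

variable {k} {C : Type w} [AddCommGroup C] [Module k C] [Coalgebra k C]

theorem apply_mem_grouplikes (f : coalgAut k C) {c : C} (hc : c ∈ grouplikes k C) :
    (f : C ≃ₗ[k] C) c ∈ grouplikes k C :=
  ⟨by rw [f.2.2, hc.1]; rfl, by rw [f.2.1, hc.2]⟩

variable (k C) in
/-- The action of coalgebra automorphisms on grouplike elements. -/
noncomputable def grouplikePerm : coalgAut k C →* Equiv.Perm (grouplikes k C) where
  toFun f :=
    { toFun := fun c => ⟨(f : C ≃ₗ[k] C) c, apply_mem_grouplikes f c.2⟩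
      invFun := fun c => ⟨((f⁻¹ : coalgAut k C) : C ≃ₗ[k] C) c, apply_mem_grouplikes f⁻¹ c.2⟩
      left_inv := fun c => Subtype.ext ((f : C ≃ₗ[k] C).symm_apply_apply c)
      right_inv := fun c => Subtype.ext ((f : C ≃ₗ[k] C).apply_symm_apply c) }
  map_one' := rfl
  map_mul' _ _ := rfl

theorem mem_span_grouplikes_of_apply (f : coalgAut k C) {c : C}
    (hc : (f : C ≃ₗ[k] C) c ∈ Submodule.span k (grouplikes k C)) :
    c ∈ Submodule.span k (grouplikes k C) := by
  have hle : Submodule.span k (grouplikes k C) ≤ (Submodule.span k (grouplikes k C)).comap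
      ((f⁻¹ : coalgAut k C) : C ≃ₗ[k] C).toLinearMap := by
    rw [Submodule.span_le]
    exact fun d hd => Submodule.subset_span (apply_mem_grouplikes f⁻¹ hd)
  have h := hle hc
  rw [Submodule.mem_comap] at h
  convert h
  exact ((f : C ≃ₗ[k] C).symm_apply_apply c).symm

end Grouplikes

/-! ### The coalgebra of a binary relation -/

/-- The coalgebra of the quiver with one edge `x → y` for each related pair. -/
abbrev RelCoalgebra {X : Type v} (r : X → X → Prop) : Type (max u v) :=
  QuiverCoalgebra k (fun p : {p : X × X // r p.1 p.2} => p.1.1) (fun p => p.1.2)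

namespace RelCoalgebra

open QuiverCoalgebra

variable {X : Type v} (r : X → X → Prop)

/-- A vertex, as an element of the coalgebra of a relation. -/
noncomputable abbrev vertex (x : X) : RelCoalgebra k r := vert k _ _ x

variable {k r}

theorem exists_vertex_eq (f : coalgAut k (RelCoalgebra k r)) (x : X) :
    ∃ y, vertex k r y = (f : RelCoalgebra k r ≃ₗ[k] RelCoalgebra k r) (vertex k r x) := by
  have h := apply_mem_grouplikes f (c := vertex k r x)
    (by rw [grouplikes_eq_range_vert]; exact ⟨x, rfl⟩)
  rw [grouplikes_eq_range_vert] at h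
  exact h

theorem rel_iff (x y : X) :
    r x y ↔ ∃ c ∉ Submodule.span k (grouplikes k (RelCoalgebra k r)),
      Coalgebra.comul (R := k) c = vertex k r x ⊗ₜ c + c ⊗ₜ vertex k r y := by
  rw [← exists_edge_iff]
  constructor
  · exact fun h => ⟨⟨(x, y), h⟩, rfl, rfl⟩
  · rintro ⟨⟨_, h⟩, rfl, rfl⟩
    exact h

theorem rel_of_apply (f : coalgAut k (RelCoalgebra k r)) {x y x' y' : X}
    (hx : vertex k r x' = (f : RelCoalgebra k r ≃ₗ[k] RelCoalgebra k r) (vertex k r x))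
    (hy : vertex k r y' = (f : RelCoalgebra k r ≃ₗ[k] RelCoalgebra k r) (vertex k r y))
    (h : r x y) : r x' y' := by
  obtain ⟨c, hc, hΔ⟩ := (rel_iff (k := k) x y).mp h
  refine (rel_iff (k := k) x' y').mpr
    ⟨_, fun h => hc (mem_span_grouplikes_of_apply f h), ?_⟩
  rw [f.2.2, hΔ, hx, hy, map_add]
  rfl

/-- Coalgebra automorphisms act on the vertices by automorphisms of the relation. -/
theorem exists_relIso (f : coalgAut k (RelCoalgebra k r)) :
    ∃ φ : r ≃r r, ∀ x, (f : RelCoalgebra k r ≃ₗ[k] RelCoalgebra k r) (vertex k r x) =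
      vertex k r (φ x) := by
  choose φ hφ using exists_vertex_eq f
  choose ψ hψ using exists_vertex_eq f⁻¹
  have hinj : Function.Injective (vertex k r) := vert_injective
  have hl : Function.LeftInverse ψ φ := fun x => by
    refine hinj ?_
    rw [hψ, hφ]
    exact (f : RelCoalgebra k r ≃ₗ[k] RelCoalgebra k r).symm_apply_apply _
  have hr : Function.RightInverse ψ φ := fun x => by
    refine hinj ?_
    rw [hφ, hψ]
    exact (f : RelCoalgebra k r ≃ₗ[k] RelCoalgebra k r).apply_symm_apply _
  refine ⟨⟨⟨φ, ψ, hl, hr⟩, fun {x y} => ⟨fun h => ?_, rel_of_apply f (hφ x) (hφ y)⟩⟩,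
    fun x => (hφ x).symm⟩
  rw [← hl x, ← hl y]
  exact rel_of_apply f⁻¹ (hψ _) (hψ _) h

/-- The permutation of the edges induced by an automorphism of the relation. -/
def edgePerm (φ : r ≃r r) : Equiv.Perm {p : X × X // r p.1 p.2} :=
  (Equiv.prodCongr φ.toEquiv φ.toEquiv).subtypeEquiv fun _ => φ.map_rel_iff.symm

/-- The linear automorphism induced by an automorphism of the relation. -/
noncomputable def ofRelIso (φ : r ≃r r) : RelCoalgebra k r ≃ₗ[k] RelCoalgebra k r :=
  (basis k _ _).equiv (basis k _ _) (Equiv.sumCongr φ.toEquiv (edgePerm φ))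

@[simp]
theorem ofRelIso_vert (φ : r ≃r r) (x : X) :
    ofRelIso φ (vertex k r x) = vertex k r (φ x) :=
  (basis k _ _).equiv_apply _ _ _

@[simp]
theorem ofRelIso_edge (φ : r ≃r r) (e : {p : X × X // r p.1 p.2}) :
    ofRelIso φ (edge k _ _ e : RelCoalgebra k r) = edge k _ _ (edgePerm φ e) :=
  (basis k _ _).equiv_apply _ _ _

theorem ofRelIso_mem (φ : r ≃r r) : ofRelIso φ ∈ coalgAut k (RelCoalgebra k r) := by
  refine ⟨LinearMap.congr_fun (f := Coalgebra.counit ∘ₗ (ofRelIso φ).toLinearMap)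
      (g := Coalgebra.counit) (linearMap_ext ?_ ?_),
    LinearMap.congr_fun (f := Coalgebra.comul ∘ₗ (ofRelIso φ).toLinearMap)
      (g := TensorProduct.map (ofRelIso φ).toLinearMap (ofRelIso φ).toLinearMap ∘ₗ
        Coalgebra.comul) (linearMap_ext ?_ ?_)⟩
  · intro x; simp
  · intro e; simp
  · intro x; simp
  · intro e; simp; rfl

variable (k r) in
/-- Automorphisms of a relation act on its coalgebra. -/
noncomputable def autHom : (r ≃r r) →* coalgAut k (RelCoalgebra k r) where
  toFun φ := ⟨ofRelIso φ, ofRelIso_mem φ⟩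
  map_one' := Subtype.ext <| LinearEquiv.toLinearMap_injective <|
    linearMap_ext (fun x => ofRelIso_vert 1 x) (fun e => ofRelIso_edge 1 e)
  map_mul' φ ψ := Subtype.ext <| LinearEquiv.toLinearMap_injective <| by
    refine linearMap_ext (fun x => ?_) (fun e => ?_)
    · simp
    · simp; rfl

theorem autHom_vertex (φ : r ≃r r) (x : X) :
    (autHom k r φ : RelCoalgebra k r ≃ₗ[k] RelCoalgebra k r) (vertex k r x) =
      vertex k r (φ x) :=
  ofRelIso_vert φ x

end RelCoalgebra

/-! ### A relation with prescribed automorphisms -/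

section RepRel

variable {G : Type v} [Group G] {V : Type w} (ρ : G →* Equiv.Perm V)

/-- The sum of the left regular representation and `ρ`. -/
def regularSum : G →* Equiv.Perm (G ⊕ V) where
  toFun g := Equiv.sumCongr (Equiv.mulLeft g) (ρ g)
  map_one' := by ext x; cases x <;> simp
  map_mul' g h := by ext x; cases x <;> simp [mul_assoc]

/-- A relation on `(G ⊕ V) ⊕ G × (G ⊕ V)`. Each `g : G` carries its own well-ordered copy
`{g} × (G ⊕ V)` of `G ⊕ V`, in which `(g, p)` points to the translate of `p` by `g`. -/
inductive RepRel : (G ⊕ V) ⊕ G × (G ⊕ V) → (G ⊕ V) ⊕ G × (G ⊕ V) → Prop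
  | loop (p : G ⊕ V) : RepRel (Sum.inl p) (Sum.inl p)
  | copy (g : G) (p : G ⊕ V) : RepRel (Sum.inl (Sum.inl g)) (Sum.inr (g, p))
  | lt (g : G) {p q : G ⊕ V} (h : WellOrderingRel p q) : RepRel (Sum.inr (g, p)) (Sum.inr (g, q))
  | translate (g : G) (p : G ⊕ V) : RepRel (Sum.inr (g, p)) (Sum.inl (regularSum ρ g p))

variable {ρ}

theorem RepRel.self_iff {x : (G ⊕ V) ⊕ G × (G ⊕ V)} : RepRel ρ x x ↔ ∃ p, x = Sum.inl p := by
  constructor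
  · intro h
    cases h with
    | loop p => exact ⟨p, rfl⟩
    | lt g h => exact absurd h (irrefl _)
  · rintro ⟨p, rfl⟩
    exact .loop p

theorem RepRel.lt_iff {g : G} {p q : G ⊕ V} :
    RepRel ρ (Sum.inr (g, p)) (Sum.inr (g, q)) ↔ WellOrderingRel p q :=
  ⟨fun h => by cases h; assumption, .lt g⟩

theorem RepRel.exists_inl (φ : RepRel ρ ≃r RepRel ρ) (p : G ⊕ V) :
    ∃ q, φ (Sum.inl p) = Sum.inl q :=
  self_iff.mp (φ.map_rel_iff.mpr (.loop p))

theorem RepRel.exists_inr (φ : RepRel ρ ≃r RepRel ρ) (a : G × (G ⊕ V)) :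
    ∃ b, φ (Sum.inr a) = Sum.inr b := by
  rcases h : φ (Sum.inr a) with p | b
  · obtain ⟨q, hq⟩ := exists_inl φ.symm p
    rw [← h, φ.symm_apply_apply] at hq
    cases hq
  · exact ⟨b, rfl⟩

theorem RepRel.exists_copy (φ : RepRel ρ ≃r RepRel ρ) (g : G) :
    ∃ g', φ (Sum.inl (Sum.inl g)) = Sum.inl (Sum.inl g') ∧
      ∀ p, ∃ q, φ (Sum.inr (g, p)) = Sum.inr (g', q) := by
  obtain ⟨p', hp'⟩ := exists_inl φ (Sum.inl g)
  have key : ∀ p, ∃ g' q, p' = Sum.inl g' ∧ φ (Sum.inr (g, p)) = Sum.inr (g', q) := by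
    intro p
    obtain ⟨b, hb⟩ := exists_inr φ (g, p)
    have h := φ.map_rel_iff.mpr (RepRel.copy (ρ := ρ) g p)
    rw [hp', hb] at h
    cases h with
    | copy g' q => exact ⟨g', q, rfl, hb⟩
  obtain ⟨g', -, rfl, -⟩ := key (Sum.inl g)
  refine ⟨g', hp', fun p => ?_⟩
  obtain ⟨g'', q, h, hq⟩ := key p
  cases h
  exact ⟨q, hq⟩

theorem RepRel.apply_inr (φ : RepRel ρ ≃r RepRel ρ) {g g' : G}
    (h : φ (Sum.inl (Sum.inl g)) = Sum.inl (Sum.inl g')) (p : G ⊕ V) :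
    φ (Sum.inr (g, p)) = Sum.inr (g', p) := by
  have key : ∀ (ψ : RepRel ρ ≃r RepRel ρ) {a b : G},
      ψ (Sum.inl (Sum.inl a)) = Sum.inl (Sum.inl b) →
      ∀ p, ∃ q, ψ (Sum.inr (a, p)) = Sum.inr (b, q) := by
    intro ψ a b hab
    obtain ⟨b', hb', hq⟩ := exists_copy ψ a
    rw [hab] at hb'
    cases hb'
    exact hq
  choose σ hσ using key φ h
  choose τ hτ using key φ.symm (a := g') (b := g) (by rw [← h, φ.symm_apply_apply])
  let e : (WellOrderingRel : G ⊕ V → G ⊕ V → Prop) ≃r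
      (WellOrderingRel : G ⊕ V → G ⊕ V → Prop) :=
    { toFun := σ
      invFun := τ
      left_inv := fun p => by
        have := hτ (σ p)
        rw [← hσ, φ.symm_apply_apply] at this
        simpa using this.symm
      right_inv := fun p => by
        have := hσ (τ p)
        rw [← hτ, φ.apply_symm_apply] at this
        simpa using this.symm
      map_rel_iff' := fun {p q} => by
        rw [← RepRel.lt_iff (ρ := ρ) (g := g) (p := p), ← φ.map_rel_iff, hσ, hσ, RepRel.lt_iff]
        rfl }
  have he : e p = p := e.toInitialSeg.eq (InitialSeg.refl _) p
  rw [hσ, show σ p = p from he]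

/-- The translation action of `G` on the underlying set of `RepRel ρ`. -/
def RepRel.translationPerm (ρ : G →* Equiv.Perm V) :
    G →* Equiv.Perm ((G ⊕ V) ⊕ G × (G ⊕ V)) where
  toFun g := Equiv.sumCongr (regularSum ρ g) (Equiv.prodCongr (Equiv.mulLeft g) (Equiv.refl _))
  map_one' := by ext x; rcases x with x | ⟨g, p⟩ <;> simp
  map_mul' g h := by ext x; rcases x with x | ⟨g, p⟩ <;> simp [mul_assoc]

theorem RepRel.translationPerm_rel (g : G) {x y : (G ⊕ V) ⊕ G × (G ⊕ V)} (h : RepRel ρ x y) :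
    RepRel ρ (translationPerm ρ g x) (translationPerm ρ g y) := by
  cases h with
  | loop p => exact .loop _
  | copy h p => exact .copy (g * h) p
  | lt h hpq => exact .lt (g * h) hpq
  | translate h p =>
    have := RepRel.translate (ρ := ρ) (g * h) p
    rwa [map_mul] at this

/-- The translation action of `G` by automorphisms of `RepRel ρ`. -/
def RepRel.translation (ρ : G →* Equiv.Perm V) : G →* (RepRel ρ ≃r RepRel ρ) where
  toFun g :=
    { toEquiv := translationPerm ρ g
      map_rel_iff' := fun {x y} => ⟨fun h => by
        simpa [← Equiv.Perm.mul_apply, ← map_mul] using translationPerm_rel g⁻¹ h,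
        translationPerm_rel g⟩ }
  map_one' := RelIso.ext fun x => by simp
  map_mul' g h := RelIso.ext fun x => by simp

/-- Every automorphism of `RepRel ρ` is a translation. -/
theorem RepRel.translation_surjective : Function.Surjective (translation ρ) := by
  intro φ
  obtain ⟨g, hg, -⟩ := exists_copy φ 1
  have hinl : ∀ p, φ (Sum.inl p) = Sum.inl (regularSum ρ g p) := by
    intro p
    have h := φ.map_rel_iff.mpr (RepRel.translate (ρ := ρ) 1 p)
    rw [apply_inr φ hg, map_one, Equiv.Perm.one_apply] at h
    obtain ⟨q, hq⟩ := exists_inl φ p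
    rw [hq] at h ⊢
    cases h
    rfl
  refine ⟨g, ?_⟩
  ext x
  rcases x with p | ⟨h, p⟩
  · exact (hinl p).symm
  · exact (apply_inr φ (hinl (Sum.inl h)) p).symm

end RepRel

theorem stmt16 (G : Type v) [Group G] (V : Type w) (ρ : G →* Equiv.Perm V) :
    ∃ C : BundledCoalgebra.{max u v w} k,
      ∃ a : G →* ↥(coalgAut k C.carrier),
        Function.Injective a ∧
        (∃ π : ↥(coalgAut k C.carrier) →* Equiv.Perm ↥(grouplikes k C.carrier),
          (∀ (f : ↥(coalgAut k C.carrier)) (c : ↥(grouplikes k C.carrier)),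
            ((π f c : ↥(grouplikes k C.carrier)) : C.carrier) =
              (f : C.carrier ≃ₗ[k] C.carrier) c) ∧
          Nonempty (π.range ≃* G)) ∧
        ∃ ι : V ↪ C.carrier,
          Set.range ι ⊆ grouplikes k C.carrier ∧
          (∀ f : ↥(coalgAut k C.carrier), ∀ v : V,
            ∃ w : V, (f : C.carrier ≃ₗ[k] C.carrier) (ι v) = ι w) ∧
          (∀ (g : G) (v : V),
            (a g : C.carrier ≃ₗ[k] C.carrier) (ι v) = ι (ρ g v)) ∧
          ∃ ρbar : G →* Equiv.Perm {c : ↥(grouplikes k C.carrier) // (c : C.carrier) ∉ Set.range ι},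
            Function.Injective ρbar ∧
            ∀ (g : G) (c : {c : ↥(grouplikes k C.carrier) // (c : C.carrier) ∉ Set.range ι}),
              (a g : C.carrier ≃ₗ[k] C.carrier) ((c : ↥(grouplikes k C.carrier)) : C.carrier) =
                ((ρbar g c : ↥(grouplikes k C.carrier)) : C.carrier) := by
  let r := RepRel ρ
  let τ := RepRel.translation ρ
  let C := RelCoalgebra k r
  let a : G →* coalgAut k C := (RelCoalgebra.autHom k r).comp τ
  have ha : ∀ g p, (a g : C ≃ₗ[k] C) (RelCoalgebra.vertex k r (Sum.inl p)) =
      RelCoalgebra.vertex k r (Sum.inl (regularSum ρ g p)) := fun g p =>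
    RelCoalgebra.autHom_vertex (τ g) (Sum.inl p)
  have hmem : ∀ x, RelCoalgebra.vertex k r x ∈ grouplikes k C := fun x => by
    rw [QuiverCoalgebra.grouplikes_eq_range_vert]
    exact ⟨x, rfl⟩
  have hvert : ∀ c : grouplikes k C, ∃ x, RelCoalgebra.vertex k r x = c := fun c =>
    QuiverCoalgebra.grouplikes_eq_range_vert.subset c.2
  have hact : ∀ f : coalgAut k C, ∃ g, ∀ x,
      (f : C ≃ₗ[k] C) (RelCoalgebra.vertex k r x) =
        (a g : C ≃ₗ[k] C) (RelCoalgebra.vertex k r x) := by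
    intro f
    obtain ⟨φ, hφ⟩ := RelCoalgebra.exists_relIso f
    obtain ⟨g, rfl⟩ := RepRel.translation_surjective φ
    exact ⟨g, fun x => (hφ x).trans (RelCoalgebra.autHom_vertex (τ g) x).symm⟩
  have hinl : ∀ g h : G, (a g : C ≃ₗ[k] C) (RelCoalgebra.vertex k r (Sum.inl (Sum.inl 1))) =
      (a h : C ≃ₗ[k] C) (RelCoalgebra.vertex k r (Sum.inl (Sum.inl 1))) → g = h := by
    intro g h hgh
    rw [ha, ha] at hgh
    simpa [regularSum] using QuiverCoalgebra.vert_injective hgh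
  have hπa : Function.Injective ((grouplikePerm k C).comp a) := fun g h hgh =>
    hinl g h (congrArg Subtype.val (Equiv.congr_fun hgh ⟨_, hmem _⟩))
  have hrange : ((grouplikePerm k C).comp a).range = (grouplikePerm k C).range := by
    refine le_antisymm ?_ ?_
    · rintro _ ⟨g, rfl⟩
      exact ⟨a g, rfl⟩
    · rintro _ ⟨f, rfl⟩
      obtain ⟨g, hg⟩ := hact f
      refine ⟨g, Equiv.ext fun c => Subtype.ext ?_⟩
      obtain ⟨x, hx⟩ := hvert c
      change (a g : C ≃ₗ[k] C) c = (f : C ≃ₗ[k] C) c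
      rw [← hx, hg]
  let ι : V ↪ C := ⟨fun v => RelCoalgebra.vertex k r (Sum.inl (Sum.inr v)), fun v w h => by
    simpa using QuiverCoalgebra.vert_injective h⟩
  have hι : ∀ g v, (a g : C ≃ₗ[k] C) (ι v) = ι (ρ g v) := fun g v => ha g (Sum.inr v)
  have hcompl : ∀ (g : G) (c : grouplikes k C),
      (grouplikePerm k C (a g) c : C) ∉ Set.range ι ↔ (c : C) ∉ Set.range ι := by
    intro g c
    refine not_congr ⟨?_, ?_⟩
    · rintro ⟨v, hv⟩
      refine ⟨ρ g⁻¹ v, (a g : C ≃ₗ[k] C).injective ?_⟩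
      rw [hι, ← Equiv.Perm.mul_apply, ← map_mul, mul_inv_cancel, map_one, Equiv.Perm.one_apply, hv]
      rfl
    · rintro ⟨v, hv⟩
      exact ⟨ρ g v, by rw [← hι, hv]; rfl⟩
  refine ⟨⟨C⟩, a, fun g h hgh => hinl g h (by rw [hgh]),
    ⟨grouplikePerm k C, fun _ _ => rfl,
      ⟨((MonoidHom.ofInjective hπa).trans (MulEquiv.subgroupCongr hrange)).symm⟩⟩,
    ι, ?_, ?_, hι, ?_⟩
  · rintro _ ⟨v, rfl⟩
    exact hmem _
  · intro f v
    obtain ⟨g, hg⟩ := hact f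
    exact ⟨ρ g v, (hg _).trans (hι g v)⟩
  · refine ⟨{ toFun := fun g => (grouplikePerm k C (a g)).subtypePerm (hcompl g)
              map_one' := ?_
              map_mul' := fun g h => ?_ }, fun g h hgh => ?_, fun g c => rfl⟩
    · ext c
      simp
    · ext c
      exact congrArg (fun f : coalgAut k C => (f : C ≃ₗ[k] C) c) (map_mul a g h)
    · refine hinl g h ?_
      have hone : RelCoalgebra.vertex k r (Sum.inl (Sum.inl 1)) ∉ Set.range ι := by
        rintro ⟨v, hv⟩
        simpa using QuiverCoalgebra.vert_injective hv
      exact congrArg (fun c => (c.1 : C)) (Equiv.congr_fun hgh ⟨⟨_, hmem _⟩, hone⟩)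
end

section
/- Let k be a field and let G and H be two co-Hopfian groups. The following are equivalent: (1) G and H are isomorphic; (2) for every k-coalgebra C, there exists an action of G on C by coalgebra automorphisms whose restriction to the set of grouplike elements G(C) is faithful if and only if there exists an action of H on C by coalgebra automorphisms whose restriction to G(C) is faithful. -/
open TensorProduct

universe u v w

variable (k : Type u) [Field k]

/-- A group is co-Hopfian if every injective endomorphism is surjective, i.e. it has no
proper subgroup isomorphic to itself. -/
def CoHopfian (G : Type*) [Group G] : Prop :=
  ∀ f : G →* G, Function.Injective f → Function.Surjective f

/-- There is an action of `G` on the coalgebra `C` by coalgebra automorphisms whose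
restriction to the set of grouplike elements of `C` is faithful. -/
def HasGlFaithfulAction (G : Type v) [Group G] (C : BundledCoalgebra.{w} k) : Prop :=
  ∃ a : G →* ↥(coalgAut k C.carrier),
    ∀ g : G, (∀ c ∈ grouplikes k C.carrier, (a g : C.carrier ≃ₗ[k] C.carrier) c = c) → g = 1

/-- The truncated path coalgebra of a quiver with vertices `V`, arrows `E`, source map `s` and
target map `t`: vertices are grouplike, arrows are skew-primitive. -/
def ArrowCoalgebra {V E : Type v} (_s _t : E → V) : Type (max u v) :=
  V ⊕ E →₀ k

namespace ArrowCoalgebra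

variable {V E : Type v} (s t : E → V)

noncomputable instance : AddCommGroup (ArrowCoalgebra k s t) :=
  inferInstanceAs (AddCommGroup (V ⊕ E →₀ k))

noncomputable instance : Module k (ArrowCoalgebra k s t) :=
  inferInstanceAs (Module k (V ⊕ E →₀ k))

/-- The basis of vertices and arrows. -/
noncomputable def basis : Module.Basis (V ⊕ E) k (ArrowCoalgebra k s t) :=
  Module.Basis.ofRepr (LinearEquiv.refl k (V ⊕ E →₀ k))

/-- The comultiplication on basis elements. -/
noncomputable def comulBasis : V ⊕ E → ArrowCoalgebra k s t ⊗[k] ArrowCoalgebra k s t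
  | .inl v => basis k s t (.inl v) ⊗ₜ basis k s t (.inl v)
  | .inr e => basis k s t (.inr e) ⊗ₜ basis k s t (.inl (s e)) +
      basis k s t (.inl (t e)) ⊗ₜ basis k s t (.inr e)

noncomputable instance : CoalgebraStruct k (ArrowCoalgebra k s t) where
  comul := (basis k s t).constr k (comulBasis k s t)
  counit := (basis k s t).constr k (Sum.elim (fun _ => 1) (fun _ => 0))

@[simp] lemma comul_vertex (v : V) : Coalgebra.comul (R := k) (basis k s t (.inl v)) =
    basis k s t (.inl v) ⊗ₜ basis k s t (.inl v) :=
  (basis k s t).constr_basis k _ _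

@[simp] lemma comul_arrow (e : E) : Coalgebra.comul (R := k) (basis k s t (.inr e)) =
    basis k s t (.inr e) ⊗ₜ basis k s t (.inl (s e)) +
      basis k s t (.inl (t e)) ⊗ₜ basis k s t (.inr e) :=
  (basis k s t).constr_basis k _ _

@[simp] lemma counit_vertex (v : V) :
    Coalgebra.counit (R := k) (basis k s t (.inl v)) = 1 :=
  (basis k s t).constr_basis k _ _

@[simp] lemma counit_arrow (e : E) :
    Coalgebra.counit (R := k) (basis k s t (.inr e)) = 0 :=
  (basis k s t).constr_basis k _ _

noncomputable instance : Coalgebra k (ArrowCoalgebra k s t) where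
  coassoc := by
    refine (basis k s t).ext ?_
    rintro (v | e)
    · simp
    · simp [TensorProduct.add_tmul, TensorProduct.tmul_add, add_assoc]
  rTensor_counit_comp_comul := by
    refine (basis k s t).ext ?_
    rintro (v | e) <;> simp
  lTensor_counit_comp_comul := by
    refine (basis k s t).ext ?_
    rintro (v | e) <;> simp

/-- The coefficient functional of `i ⊗ j` on the tensor square. -/
noncomputable def coeff (i j : V ⊕ E) :
    ArrowCoalgebra k s t ⊗[k] ArrowCoalgebra k s t →ₗ[k] k :=
  LinearMap.mul' k k ∘ₗ TensorProduct.map ((basis k s t).coord i) ((basis k s t).coord j)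

@[simp] lemma coeff_tmul (i j : V ⊕ E) (x y : ArrowCoalgebra k s t) :
    coeff k s t i j (x ⊗ₜ y) = (basis k s t).repr x i * (basis k s t).repr y j := rfl

open Classical in
lemma coeff_vertex_vertex (v w : V) (x : ArrowCoalgebra k s t) :
    coeff k s t (.inl v) (.inl w) (Coalgebra.comul x) =
      if v = w then (basis k s t).repr x (.inl v) else 0 := by
  suffices h : coeff k s t (.inl v) (.inl w) ∘ₗ Coalgebra.comul =
      if v = w then (basis k s t).coord (.inl v) else 0 by
    have := LinearMap.congr_fun h x
    split_ifs at this ⊢ <;> exact this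
  refine (basis k s t).ext ?_
  rintro (u | e) <;> split_ifs with h
  · simp [h, Finsupp.single_apply]
  · by_cases huv : u = v
    · simp [huv, h]
    · simp [huv]
  · simp
  · simp

lemma coeff_arrow_arrow (d e : E) (x : ArrowCoalgebra k s t) :
    coeff k s t (.inr d) (.inr e) (Coalgebra.comul x) = 0 := by
  suffices h : coeff k s t (.inr d) (.inr e) ∘ₗ Coalgebra.comul = 0 from
    LinearMap.congr_fun h x
  refine (basis k s t).ext ?_
  rintro (u | e) <;> simp

lemma coeff_arrow_source (e : E) (x : ArrowCoalgebra k s t) :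
    coeff k s t (.inr e) (.inl (s e)) (Coalgebra.comul x) = (basis k s t).repr x (.inr e) := by
  classical
  suffices h : coeff k s t (.inr e) (.inl (s e)) ∘ₗ Coalgebra.comul =
      (basis k s t).coord (.inr e) from LinearMap.congr_fun h x
  refine (basis k s t).ext ?_
  rintro (u | d)
  · simp
  · by_cases hde : d = e <;> simp [Finsupp.single_apply, hde]

lemma coeff_target_arrow (e : E) (x : ArrowCoalgebra k s t) :
    coeff k s t (.inl (t e)) (.inr e) (Coalgebra.comul x) = (basis k s t).repr x (.inr e) := by
  classical
  suffices h : coeff k s t (.inl (t e)) (.inr e) ∘ₗ Coalgebra.comul =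
      (basis k s t).coord (.inr e) from LinearMap.congr_fun h x
  refine (basis k s t).ext ?_
  rintro (u | d)
  · simp
  · by_cases hde : d = e <;> simp [Finsupp.single_apply, hde]

lemma vertex_mem_grouplikes (v : V) :
    basis k s t (.inl v) ∈ grouplikes k (ArrowCoalgebra k s t) :=
  ⟨comul_vertex k s t v, counit_vertex k s t v⟩

lemma exists_vertex_of_mem_grouplikes {c : ArrowCoalgebra k s t}
    (hc : c ∈ grouplikes k (ArrowCoalgebra k s t)) : ∃ v, c = basis k s t (.inl v) := by
  classical
  obtain ⟨hΔ, hε⟩ := hc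
  have harrow (e : E) : (basis k s t).repr c (.inr e) = 0 := by
    have h := coeff_arrow_arrow k s t e e c
    rw [hΔ, coeff_tmul] at h
    exact mul_self_eq_zero.mp h
  have hvertex (v w : V) := coeff_vertex_vertex k s t v w c
  simp only [hΔ, coeff_tmul] at hvertex
  obtain ⟨v, hv⟩ : ∃ v, (basis k s t).repr c (.inl v) ≠ 0 := by
    by_contra! h
    have h0 : c = 0 := by
      refine (basis k s t).ext_elem ?_
      rintro (v | e) <;> simp [h, harrow]
    simp [h0] at hε
  refine ⟨v, (basis k s t).ext_elem ?_⟩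
  rintro (w | e)
  · by_cases hvw : v = w
    · subst hvw
      have h := hvertex v v
      rw [if_pos rfl] at h
      simpa using mul_left_cancel₀ hv (h.trans (mul_one _).symm)
    · have h := hvertex v w
      rw [if_neg hvw] at h
      simpa [hvw, hv] using h
  · simp [harrow]

/-- The `(g, h)`-skew-primitive elements. -/
def skewPrimitives {C : Type w} [AddCommGroup C] [Module k C] [Coalgebra k C] (g h : C) :
    Submodule k C :=
  LinearMap.ker (Coalgebra.comul (R := k) - (TensorProduct.mk k C C).flip g -
    TensorProduct.mk k C C h)

lemma mem_skewPrimitives {C : Type w} [AddCommGroup C] [Module k C] [Coalgebra k C]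
    {g h x : C} :
    x ∈ skewPrimitives k g h ↔ Coalgebra.comul (R := k) x = x ⊗ₜ g + h ⊗ₜ x := by
  simp [skewPrimitives, sub_sub, sub_eq_zero]

lemma rank_skewPrimitives_le {C : Type w} [AddCommGroup C] [Module k C] [Coalgebra k C]
    {f : C ≃ₗ[k] C} (hf : f ∈ coalgAut k C) (g h : C) :
    Module.rank k (skewPrimitives k g h) ≤ Module.rank k (skewPrimitives k (f g) (f h)) := by
  have hmaps : ∀ x ∈ skewPrimitives k g h, f x ∈ skewPrimitives k (f g) (f h) := by
    intro x hx
    rw [mem_skewPrimitives] at hx ⊢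
    rw [hf.2, hx]
    simp
  exact LinearMap.rank_le_of_injective (f.toLinearMap.restrict hmaps)
    fun x y hxy => Subtype.ext (f.injective (congrArg Subtype.val hxy))

lemma rank_skewPrimitives_eq {C : Type w} [AddCommGroup C] [Module k C] [Coalgebra k C]
    {f : C ≃ₗ[k] C} (hf : f ∈ coalgAut k C) (g h : C) :
    Module.rank k (skewPrimitives k (f g) (f h)) = Module.rank k (skewPrimitives k g h) := by
  refine le_antisymm ?_ (rank_skewPrimitives_le k hf g h)
  have := rank_skewPrimitives_le k ((coalgAut k C).inv_mem hf) (f g) (f h)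
  rwa [← LinearEquiv.mul_apply, ← LinearEquiv.mul_apply, inv_mul_cancel] at this

lemma skewPrimitives_le (g h : V) :
    skewPrimitives k (basis k s t (.inl g)) (basis k s t (.inl h)) ≤
      Submodule.span k (basis k s t ''
        ({.inl g, .inl h} ∪ Sum.inr '' {e | s e = g ∧ t e = h})) := by
  classical
  intro x hx
  rw [mem_skewPrimitives] at hx
  rw [Module.Basis.mem_span_image]
  intro i hi
  rw [Finset.mem_coe, Finsupp.mem_support_iff] at hi
  rcases i with v | e
  · left
    by_contra hv
    simp only [Set.mem_insert_iff, Sum.inl.injEq, Set.mem_singleton_iff, not_or] at hv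
    have := coeff_vertex_vertex k s t v v x
    rw [hx, if_pos rfl] at this
    simp [Ne.symm hv.1, Ne.symm hv.2] at this
    exact hi this.symm
  · right
    refine ⟨e, ⟨?_, ?_⟩, rfl⟩
    · by_contra hs
      have := coeff_arrow_source k s t e x
      rw [hx] at this
      simp [Ne.symm hs] at this
      exact hi this.symm
    · by_contra ht
      have := coeff_target_arrow k s t e x
      rw [hx] at this
      simp [Ne.symm ht] at this
      exact hi this.symm

lemma le_skewPrimitives (g h : V) :
    Submodule.span k (basis k s t '' (Sum.inr '' {e | s e = g ∧ t e = h})) ≤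
      skewPrimitives k (basis k s t (.inl g)) (basis k s t (.inl h)) := by
  rw [Submodule.span_le]
  rintro _ ⟨_, ⟨e, ⟨rfl, rfl⟩, rfl⟩, rfl⟩
  exact (mem_skewPrimitives k).mpr (comul_arrow k s t e)

lemma rank_span_basis (S : Set (V ⊕ E)) :
    Module.rank k (Submodule.span k (basis k s t '' S)) =
      Cardinal.lift.{u} (Cardinal.mk S) := by
  have hli := (basis k s t).linearIndependent.comp _ (Subtype.val_injective (p := (· ∈ S)))
  have hrange : basis k s t '' S = Set.range (basis k s t ∘ ((↑) : S → V ⊕ E)) := by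
    rw [Set.range_comp, Subtype.range_coe]
  rw [hrange, ← Cardinal.lift_inj.{max u v, v}, rank_span hli,
    Cardinal.mk_range_eq_of_injective hli.injective]
  simp

/-- For infinitely many arrows from `g` to `h`, their number is the dimension of the space of
skew-primitives. -/
lemma rank_skewPrimitives_vertices (g h : V)
    (hinf : Cardinal.aleph0 ≤ Cardinal.mk {e | s e = g ∧ t e = h}) :
    Module.rank k (skewPrimitives k (basis k s t (.inl g)) (basis k s t (.inl h))) =
      Cardinal.lift.{u} (Cardinal.mk {e | s e = g ∧ t e = h}) := by
  apply le_antisymm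
  · refine (Submodule.rank_mono (skewPrimitives_le k s t g h)).trans ?_
    rw [rank_span_basis, Cardinal.lift_le]
    refine (Cardinal.mk_union_le _ _).trans (Cardinal.add_le_of_le hinf ?_ Cardinal.mk_image_le)
    exact ((Set.toFinite _).lt_aleph0.le).trans hinf
  · refine le_of_eq_of_le ?_ (Submodule.rank_mono (le_skewPrimitives k s t g h))
    rw [rank_span_basis, Cardinal.mk_image_eq Sum.inr_injective]

end ArrowCoalgebra

section Cayley

variable (G : Type v)

/-- Infinite types with pairwise distinct cardinalities indexed by `G`. -/
noncomputable def Color (c : G) : Type v :=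
  (Cardinal.aleph (Ordinal.typein (α := G) WellOrderingRel c)).out

lemma mk_color (c : G) :
    Cardinal.mk (Color G c) = Cardinal.aleph (Ordinal.typein (α := G) WellOrderingRel c) :=
  Cardinal.mk_out _

lemma mk_color_injective : Function.Injective fun c : G => Cardinal.mk (Color G c) := by
  intro c d h
  simp only [mk_color] at h
  exact Ordinal.typein_injective _ (Cardinal.aleph.injective h)

variable [Group G]

/-- The arrows of the Cayley quiver of `G`, in which the arrows labelled by `c` are replaced by
`Color G c`-many parallel arrows. -/
abbrev CayleyArrow : Type v := Σ c : G, G × Color G c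

/-- The source of an arrow. -/
abbrev CayleyArrow.source (e : CayleyArrow G) : G := e.2.1

/-- The target of an arrow. -/
abbrev CayleyArrow.target (e : CayleyArrow G) : G := e.2.1 * e.1

lemma mk_cayleyArrow (g h : G) :
    Cardinal.mk {e : CayleyArrow G | CayleyArrow.source G e = g ∧ CayleyArrow.target G e = h} =
      Cardinal.mk (Color G (g⁻¹ * h)) := by
  symm
  refine Cardinal.mk_congr (Equiv.ofBijective
    (fun i => ⟨⟨g⁻¹ * h, g, i⟩, rfl, mul_inv_cancel_left g h⟩) ⟨fun i j hij => ?_, ?_⟩)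
  · simpa using hij
  · rintro ⟨⟨c, g', i⟩, hs, ht⟩
    simp only [CayleyArrow.source, CayleyArrow.target] at hs ht
    subst hs
    obtain rfl : c = g'⁻¹ * h := by rw [← ht, inv_mul_cancel_left]
    exact ⟨i, rfl⟩

/-- The arrow coalgebra of the Cayley quiver. -/
abbrev CayleyCoalgebra : Type (max u v) :=
  ArrowCoalgebra k (CayleyArrow.source G) (CayleyArrow.target G)

/-- The vertices and arrows of the Cayley quiver as a basis. -/
noncomputable abbrev cayleyBasis : Module.Basis (G ⊕ CayleyArrow G) k (CayleyCoalgebra k G) :=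
  ArrowCoalgebra.basis k _ _

/-- Left translation on the Cayley quiver. -/
def cayleyTranslate : G →* Equiv.Perm (G ⊕ CayleyArrow G) where
  toFun x := Equiv.sumCongr (Equiv.mulLeft x)
    (Equiv.sigmaCongrRight fun _ => Equiv.prodCongr (Equiv.mulLeft x) (Equiv.refl _))
  map_one' := by
    ext (g | ⟨c, g, i⟩) <;> simp
  map_mul' x y := by
    ext (g | ⟨c, g, i⟩) <;> simp [mul_assoc]

/-- The linear action by left translation on the Cayley coalgebra. -/
noncomputable def cayleyLinear : G →* (CayleyCoalgebra k G ≃ₗ[k] CayleyCoalgebra k G) where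
  toFun x := (cayleyBasis k G).equiv (cayleyBasis k G) (cayleyTranslate G x)
  map_one' := LinearEquiv.toLinearMap_injective <| (cayleyBasis k G).ext fun i => by simp
  map_mul' x y := LinearEquiv.toLinearMap_injective <| (cayleyBasis k G).ext fun i => by simp

lemma cayleyLinear_basis (x : G) (i : G ⊕ CayleyArrow G) :
    cayleyLinear k G x (cayleyBasis k G i) = cayleyBasis k G (cayleyTranslate G x i) :=
  (cayleyBasis k G).equiv_apply _ _ _

lemma cayleyLinear_mem (x : G) : cayleyLinear k G x ∈ coalgAut k (CayleyCoalgebra k G) := by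
  constructor
  · refine LinearMap.congr_fun (f := Coalgebra.counit ∘ₗ (cayleyLinear k G x).toLinearMap)
      ((cayleyBasis k G).ext ?_)
    rintro (g | e) <;> simp [cayleyLinear_basis, cayleyTranslate]
  · refine LinearMap.congr_fun (f := Coalgebra.comul ∘ₗ (cayleyLinear k G x).toLinearMap)
      (g := TensorProduct.map (cayleyLinear k G x).toLinearMap (cayleyLinear k G x).toLinearMap ∘ₗ
        Coalgebra.comul) ((cayleyBasis k G).ext ?_)
    rintro (g | e)
    · simp [cayleyLinear_basis, cayleyTranslate]
    · simp [cayleyLinear_basis, cayleyTranslate, CayleyArrow.source, CayleyArrow.target,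
        mul_assoc]

/-- The bundled Cayley coalgebra. -/
noncomputable def cayleyBundled : BundledCoalgebra.{max u v} k where
  carrier := CayleyCoalgebra k G

lemma hasGlFaithfulAction_cayley :
    HasGlFaithfulAction.{u, v, max u v} k G (cayleyBundled k G) := by
  refine ⟨(cayleyLinear k G).codRestrict (coalgAut k (CayleyCoalgebra k G))
    (cayleyLinear_mem k G), fun x hx => ?_⟩
  have h : cayleyLinear k G x (cayleyBasis k G (.inl 1)) = cayleyBasis k G (.inl 1) :=
    hx _ (ArrowCoalgebra.vertex_mem_grouplikes k _ _ 1)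
  rw [cayleyLinear_basis] at h
  simpa [cayleyTranslate] using (cayleyBasis k G).injective h

lemma coalgAut_map_mem_grouplikes {C : Type w} [AddCommGroup C] [Module k C] [Coalgebra k C]
    {f : C ≃ₗ[k] C} (hf : f ∈ coalgAut k C) {c : C} (hc : c ∈ grouplikes k C) :
    f c ∈ grouplikes k C :=
  ⟨by rw [hf.2, hc.1]; simp, by rw [hf.1, hc.2]⟩

/-- A coalgebra automorphism of the Cayley coalgebra acts on vertices by a left translation. -/
lemma exists_translate {f : CayleyCoalgebra k G ≃ₗ[k] CayleyCoalgebra k G}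
    (hf : f ∈ coalgAut k (CayleyCoalgebra k G)) :
    ∃ x : G, ∀ g, f (cayleyBasis k G (.inl g)) = cayleyBasis k G (.inl (x * g)) := by
  choose σ hσ using fun g => ArrowCoalgebra.exists_vertex_of_mem_grouplikes k _ _
    (coalgAut_map_mem_grouplikes k hf (ArrowCoalgebra.vertex_mem_grouplikes k
      (CayleyArrow.source G) (CayleyArrow.target G) g))
  have hrank (g h : G) :
      Module.rank k (ArrowCoalgebra.skewPrimitives k (cayleyBasis k G (.inl g))
        (cayleyBasis k G (.inl h))) = Cardinal.lift.{u} (Cardinal.mk (Color G (g⁻¹ * h))) := by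
    rw [ArrowCoalgebra.rank_skewPrimitives_vertices, mk_cayleyArrow]
    rw [mk_cayleyArrow, mk_color]
    exact Cardinal.aleph0_le_aleph _
  refine ⟨σ 1, fun g => ?_⟩
  have h := ArrowCoalgebra.rank_skewPrimitives_eq k hf (cayleyBasis k G (.inl 1))
    (cayleyBasis k G (.inl g))
  rw [hσ, hσ, hrank, hrank, Cardinal.lift_inj] at h
  have h' := mk_color_injective G h
  rw [inv_one, one_mul, inv_mul_eq_iff_eq_mul] at h'
  rw [hσ, h']

lemma exists_injective_of_hasGlFaithfulAction_cayley (L : Type v) [Group L]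
    (hL : HasGlFaithfulAction.{u, v, max u v} k L (cayleyBundled k G)) :
    ∃ f : L →* G, Function.Injective f := by
  obtain ⟨a, ha⟩ := hL
  change L →* coalgAut k (CayleyCoalgebra k G) at a
  choose f hf using fun l => exists_translate k G (a l).2
  have hinj {x y : G} (h : cayleyBasis k G (.inl x) = cayleyBasis k G (.inl y)) : x = y :=
    Sum.inl_injective ((cayleyBasis k G).injective h)
  refine ⟨MonoidHom.mk' f fun l m => hinj ?_, (injective_iff_map_eq_one _).mpr fun l hl => ha l ?_⟩
  · rw [← mul_one (f l * f m), mul_assoc, ← hf l, ← hf m, ← mul_one (f (l * m)), ← hf, map_mul]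
    rfl
  · intro c hc
    obtain ⟨g, rfl⟩ := ArrowCoalgebra.exists_vertex_of_mem_grouplikes k _ _ hc
    rw [MonoidHom.mk'_apply] at hl
    refine (hf l g).trans ?_
    rw [hl, one_mul]

end Cayley

lemma HasGlFaithfulAction.of_mulEquiv {G H : Type v} [Group G] [Group H] (φ : G ≃* H)
    {C : BundledCoalgebra.{w} k} (h : HasGlFaithfulAction k G C) :
    HasGlFaithfulAction k H C := by
  obtain ⟨a, ha⟩ := h
  exact ⟨a.comp φ.symm.toMonoidHom, fun x hx => φ.symm.map_eq_one_iff.mp (ha _ hx)⟩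

theorem stmt17 (G H : Type v) [Group G] [Group H] (hG : CoHopfian G) (hH : CoHopfian H) :
    Nonempty (G ≃* H) ↔
      ∀ C : BundledCoalgebra.{max u v} k,
        (HasGlFaithfulAction.{u, v, max u v} k G C ↔ HasGlFaithfulAction.{u, v, max u v} k H C) := by
  constructor
  · rintro ⟨φ⟩ C
    exact ⟨.of_mulEquiv k φ, .of_mulEquiv k φ.symm⟩
  · intro h
    obtain ⟨p, hp⟩ := exists_injective_of_hasGlFaithfulAction_cayley k G H
      ((h _).mp (hasGlFaithfulAction_cayley k G))
    obtain ⟨q, hq⟩ := exists_injective_of_hasGlFaithfulAction_cayley k H G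
      ((h _).mpr (hasGlFaithfulAction_cayley k H))
    have hsurj : Function.Surjective p :=
      Function.Surjective.of_comp (g := q) (hG (p.comp q) (hp.comp hq))
    exact ⟨(MulEquiv.ofBijective p ⟨hp, hsurj⟩).symm⟩
end
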